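/- Fix k ≥ 2 and let p be the offspring law with p(k) = 1/k and p(0) = 1 − 1/k. Then the Cramér rate function I_p(x) = sup_λ {λx − log(p(0) + p(k)e^{λk})} equals (x/k) log x + (1 − x/k) log((1 − x/k)/(1 − 1/k)) for 0 ≤ x ≤ k, and consequently, for the Markov chain X with irreducible kernel Q indexed by this Galton-Watson tree conditioned on {|T| = n} (equivalently, a uniformly random k-ary tree with n vertices), the empirical pair measure L_X satisfies a large deviation principle with speed n and good rate function I(μ) = H(μ ∥ μ₁ ⊗ Q) + ((k−1)/k) H((kμ₂ − μ₁)/(k−1) ∥ μ₂) + (1/k) H(μ₁ ∥ μ₂) when kμ₂ ≥ μ₁ pointwise, and I(μ) = ∞ otherwise. -/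

import Mathlib

open scoped ENNReal NNReal BigOperators
open Filter

/-- Finite rooted planar trees with vertex types in `𝒳`. -/
inductive PTree (𝒳 : Type*) where
  | node : 𝒳 → List (PTree 𝒳) → PTree 𝒳

namespace PTree

variable {𝒳 : Type*}

/-- The type of the root. -/
def root : PTree 𝒳 → 𝒳
  | node a _ => a

/-- The list of subtrees rooted at the children of the root (left to right). -/
def children : PTree 𝒳 → List (PTree 𝒳)
  | node _ ts => ts

/-- The types of the children of the root, from left to right. -/
def childLabels (t : PTree 𝒳) : List 𝒳 := t.children.map root

/-- The list of all subtrees `X^v`, `v` a vertex of the tree. -/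
def subtrees : PTree 𝒳 → List (PTree 𝒳)
  | node a ts => node a ts :: (ts.attach.map (fun s => subtrees s.1)).flatten
decreasing_by
  have := List.sizeOf_lt_of_mem s.2
  simp only [PTree.node.sizeOf_spec]
  omega

/-- Number of vertices. -/
def size (t : PTree 𝒳) : ℕ := t.subtrees.length

/-- The vertices at depth exactly `k`, as subtrees, from left to right. -/
def atDepth : ℕ → PTree 𝒳 → List (PTree 𝒳)
  | 0, t => [t]
  | (k+1), node _ ts => (ts.attach.map (fun s => atDepth k s.1)).flatten

/-- Truncation of a tree at height `k` (keeping the generations `0,…,k`). -/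
def trunc : ℕ → PTree 𝒳 → PTree 𝒳
  | 0, node a _ => node a []
  | (k+1), node a ts => node a (ts.attach.map (fun s => trunc k s.1))

/-- The height of a tree (largest `k` such that generation `k` is nonempty). -/
def height : PTree 𝒳 → ℕ
  | node _ [] => 0
  | node _ (t :: ts) => ((t :: ts).attach.map (fun s => height s.1)).foldr max 0 + 1
decreasing_by
  have := List.sizeOf_lt_of_mem s.2
  simp only [PTree.node.sizeOf_spec] at *
  omega

/-- The largest offspring number in the tree. -/
def maxDeg : PTree 𝒳 → ℕ
  | node _ ts => max ts.length (((ts.attach.map (fun s => maxDeg s.1)).foldr max 0))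
decreasing_by
  have := List.sizeOf_lt_of_mem s.2
  simp only [PTree.node.sizeOf_spec] at *
  omega

end PTree
noncomputable instance {𝒳 : Type*} : DecidableEq (PTree 𝒳) := Classical.decEq _

/-- Extended-real logarithm of an extended nonnegative real. -/
noncomputable def elog (x : ℝ≥0∞) : EReal :=
  if x = 0 then ⊥ else if x = ∞ then ⊤ else ((Real.log x.toReal : ℝ) : EReal)

open Classical in
/-- Relative entropy `H(ν ‖ ρ)` of two (probability) vectors on a countable set,
with value `∞` if `ν` is not absolutely continuous with respect to `ρ`.  (For
probability vectors each summand below is nonnegative and the sum equals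
`∑ ν a log (ν a / ρ a)`.) -/
noncomputable def relEnt {α : Type*} (ν ρ : α → ℝ) : ℝ≥0∞ :=
  if ∀ a, ρ a = 0 → ν a = 0 then
    ∑' a, ENNReal.ofReal (ν a * Real.log (ν a / ρ a) + ρ a - ν a)
  else ∞

/-- The Cramér rate function `I_p(x) = sup_λ {λx - log ∑ p(n) e^{λn}}`. -/
noncomputable def cramerRate (p : ℕ → ℝ) (x : ℝ) : EReal :=
  ⨆ lam : ℝ, ((lam * x - Real.log (∑' n : ℕ, p n * Real.exp (lam * n)) : ℝ) : EReal)

/-- Total mass `P{|T| = n}` assigned by the weight `w` to trees with `n` vertices. -/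
noncomputable def treeMass {𝒳 : Type*} (w : PTree 𝒳 → ℝ) (n : ℕ) : ℝ≥0∞ :=
  ∑' t : PTree 𝒳, if t.size = n then ENNReal.ofReal (w t) else 0

open Classical in
/-- Conditional probability of the event `E` given `{|T| = n}`, for the (sub)probability
weight `w` on finite planar trees.  -/
noncomputable def condP {𝒳 : Type*} (w : PTree 𝒳 → ℝ) (n : ℕ) (E : Set (PTree 𝒳)) : ℝ≥0∞ :=
  (∑' t : PTree 𝒳, if t.size = n ∧ t ∈ E then ENNReal.ofReal (w t) else 0) / treeMass w n

/-- The set of sizes having positive probability. -/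
noncomputable def sizeSupport {𝒳 : Type*} (w : PTree 𝒳 → ℝ) : Set ℕ := {n | 0 < treeMass w n}
section TreeIndexedChain

variable {𝒳 : Type*} [Fintype 𝒳] [DecidableEq 𝒳]

/-- The joint weight of a typed tree under the Galton-Watson law with offspring
distribution `p`, initial type distribution `μ0` and Markov transition kernel `Q`:
`μ0(root) ∏_v p(N(v)) ∏_{children w of v} Q(type w | type v)`. -/
noncomputable def jointWeight (p : ℕ → ℝ) (μ0 : 𝒳 → ℝ) (Q : 𝒳 → 𝒳 → ℝ) (t : PTree 𝒳) : ℝ :=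
  μ0 t.root *
    (t.subtrees.map (fun s => p s.children.length *
      (s.children.map (fun c => Q s.root c.root)).prod)).prod

/-- The number of edges of `t` whose beginning vertex has type `a` and whose end
vertex has type `b`. -/
noncomputable def pairCount (t : PTree 𝒳) (a b : 𝒳) : ℕ :=
  (t.subtrees.map (fun s => if s.root = a then s.childLabels.count b else 0)).sum

/-- The empirical pair measure `L_X`. -/
noncomputable def empPair (t : PTree 𝒳) : 𝒳 × 𝒳 → ℝ :=
  fun x => (pairCount t x.1 x.2 : ℝ) / ((t.size : ℝ) - 1)

/-- Probability vectors on `𝒳 × 𝒳`. -/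
def IsProbVec (μ : 𝒳 × 𝒳 → ℝ) : Prop := (∀ x, 0 ≤ μ x) ∧ ∑ x, μ x = 1

/-- The space of probability vectors on `𝒳 × 𝒳` (with its natural topology). -/
abbrev PV (𝒳 : Type*) [Fintype 𝒳] [DecidableEq 𝒳] := {μ : 𝒳 × 𝒳 → ℝ // IsProbVec μ}

end TreeIndexedChain
section Statement2

variable {𝒳 : Type*} [Fintype 𝒳] [DecidableEq 𝒳]

/-- The offspring law of `k`-ary trees: `p(k) = 1/k`, `p(0) = 1 - 1/k`. -/
noncomputable def karyLaw (k : ℕ) (ℓ : ℕ) : ℝ :=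
  if ℓ = k then 1 / k else if ℓ = 0 then 1 - 1 / k else 0

open Classical in
/-- The rate function for the empirical pair measure of a Markov chain indexed by a
uniform `k`-ary tree with `n` vertices. -/
noncomputable def rateKary (k : ℕ) (Q : 𝒳 → 𝒳 → ℝ) (μ : 𝒳 × 𝒳 → ℝ) : EReal :=
  let μ1 : 𝒳 → ℝ := fun a => ∑ b, μ (a, b)
  let μ2 : 𝒳 → ℝ := fun b => ∑ a, μ (a, b)
  if ∀ a, μ1 a ≤ k * μ2 a then
    (relEnt μ (fun x => μ1 x.1 * Q x.1 x.2) : EReal)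
      + ((((k : ℝ) - 1) / k : ℝ) : EReal) *
          (relEnt (fun a => (k * μ2 a - μ1 a) / ((k : ℝ) - 1)) μ2 : EReal)
      + ((1 / (k : ℝ) : ℝ) : EReal) * (relEnt μ1 μ2 : EReal)
  else ⊤

set_option linter.unusedSectionVars false
set_option linter.unusedDecidableInType false
set_option linter.unusedFintypeInType false

namespace KaryTree

theorem induct {α : Type*} {P : PTree α → Prop}
    (h : ∀ a ts, (∀ t ∈ ts, P t) → P (PTree.node a ts)) : ∀ t, P t := by
  intro t
  refine PTree.rec (motive_1 := P) (motive_2 := fun ts => ∀ t ∈ ts, P t) h ?_ ?_ t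
  · simp
  · intro t ts ht hts s hs
    rcases List.mem_cons.1 hs with rfl | hs
    exacts [ht, hts s hs]

theorem subtrees_node {α : Type*} (a : α) (ts : List (PTree α)) :
    (PTree.node a ts).subtrees = PTree.node a ts :: (ts.map PTree.subtrees).flatten := by
  rw [PTree.subtrees]
  simp

theorem size_node {α : Type*} (a : α) (ts : List (PTree α)) :
    (PTree.node a ts).size = 1 + (ts.map PTree.size).sum := by
  unfold PTree.size
  rw [subtrees_node, List.length_cons, List.length_flatten, List.map_map, add_comm]
  rfl

theorem pairCount_node (a : 𝒳) (ts : List (PTree 𝒳)) (x y : 𝒳) :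
    pairCount (PTree.node a ts) x y =
      (if a = x then (ts.map PTree.root).count y else 0) +
        (ts.map fun c => pairCount c x y).sum := by
  unfold pairCount
  rw [subtrees_node, List.map_cons, List.sum_cons, List.map_flatten, List.sum_flatten]
  simp only [List.map_map]
  rfl

/-- The weight of a typed tree with the initial distribution left out. -/
noncomputable def weight (k : ℕ) (Q : 𝒳 → 𝒳 → ℝ) (t : PTree 𝒳) : ℝ :=
  (t.subtrees.map (fun s => karyLaw k s.children.length *
      (s.children.map (fun c => Q s.root c.root)).prod)).prod

theorem weight_node (k : ℕ) (Q : 𝒳 → 𝒳 → ℝ) (a : 𝒳) (ts : List (PTree 𝒳)) :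
    weight k Q (PTree.node a ts) =
      karyLaw k ts.length * (ts.map fun c => Q a c.root).prod * (ts.map (weight k Q)).prod := by
  unfold weight
  rw [subtrees_node, List.map_cons, List.prod_cons, List.map_flatten, List.prod_flatten]
  simp only [List.map_map]
  rfl

theorem karyLaw_self (k : ℕ) : karyLaw k k = 1 / k := by simp [karyLaw]

theorem karyLaw_zero {k : ℕ} (hk : 2 ≤ k) : karyLaw k 0 = 1 - 1 / k := by
  have : (0 : ℕ) ≠ k := by omega
  simp [karyLaw, this]

theorem karyLaw_zero_pos {k : ℕ} (hk : 2 ≤ k) : 0 < 1 - 1 / (k : ℝ) := by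
  have : (2 : ℝ) ≤ k := by exact_mod_cast hk
  have h : 1 / (k : ℝ) < 1 := by rw [div_lt_one (by linarith)]; linarith
  linarith

theorem karyLaw_nonneg {k : ℕ} (hk : 2 ≤ k) (n : ℕ) : 0 ≤ karyLaw k n := by
  have := karyLaw_zero_pos hk
  unfold karyLaw
  split_ifs
  · positivity
  · exact this.le
  · exact le_rfl

theorem weight_leaf {k : ℕ} (hk : 2 ≤ k) (Q : 𝒳 → 𝒳 → ℝ) (a : 𝒳) :
    weight k Q (PTree.node a []) = 1 - 1 / k := by
  simp [weight_node, karyLaw_zero hk]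

theorem weight_nonneg {k : ℕ} (hk : 2 ≤ k) {Q : 𝒳 → 𝒳 → ℝ} (hQ : ∀ a b, 0 ≤ Q a b)
    (t : PTree 𝒳) : 0 ≤ weight k Q t := by
  induction t using induct with
  | h a ts ih =>
    rw [weight_node]
    refine mul_nonneg (mul_nonneg (karyLaw_nonneg hk _) ?_) ?_ <;>
    · apply List.prod_nonneg
      simp only [List.mem_map]
      rintro _ ⟨c, hc, rfl⟩
      first | exact hQ _ _ | exact ih _ hc

theorem weight_ne_zero {k : ℕ} {Q : 𝒳 → 𝒳 → ℝ} {a : 𝒳} {ts : List (PTree 𝒳)}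
    (h : weight k Q (PTree.node a ts) ≠ 0) :
    (ts.length = k ∨ ts = []) ∧ ∀ c ∈ ts, Q a c.root ≠ 0 ∧ weight k Q c ≠ 0 := by
  rw [weight_node] at h
  obtain ⟨h12, h3⟩ := mul_ne_zero_iff.1 h
  obtain ⟨h1, h2⟩ := mul_ne_zero_iff.1 h12
  refine ⟨?_, fun c hc => ⟨?_, ?_⟩⟩
  · unfold karyLaw at h1
    split_ifs at h1 with h h'
    · exact Or.inl h
    · exact Or.inr (List.length_eq_zero_iff.1 h')
    · exact absurd rfl h1
  · intro h0
    exact h2 (List.prod_eq_zero (List.mem_map.2 ⟨c, hc, h0⟩))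
  · intro h0
    exact h3 (List.prod_eq_zero (List.mem_map.2 ⟨c, hc, h0⟩))

theorem jointWeight_eq (k : ℕ) (μ0 : 𝒳 → ℝ) (Q : 𝒳 → 𝒳 → ℝ) (t : PTree 𝒳) :
    jointWeight (karyLaw k) μ0 Q t = μ0 t.root * weight k Q t := rfl

/-- The sum of `g` over the edges of a typed tree. -/
noncomputable def edgeSum (g : 𝒳 → 𝒳 → ℝ) (t : PTree 𝒳) : ℝ :=
  ∑ x, ∑ y, (pairCount t x y : ℝ) * g x y

theorem sum_count_mul (l : List 𝒳) (f : 𝒳 → ℝ) :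
    ∑ y, (l.count y : ℝ) * f y = (l.map f).sum := by
  induction l with
  | nil => simp
  | cons b l ih =>
    simp only [List.count_cons, List.map_cons, List.sum_cons, Nat.cast_add, add_mul,
      Finset.sum_add_distrib, ih]
    simp [add_comm]

theorem edgeSum_node (g : 𝒳 → 𝒳 → ℝ) (a : 𝒳) (ts : List (PTree 𝒳)) :
    edgeSum g (PTree.node a ts) =
      (ts.map fun c => g a c.root).sum + (ts.map (edgeSum g)).sum := by
  have h1 : ∑ x, ∑ y, ((if a = x then (ts.map PTree.root).count y else 0 : ℕ) : ℝ) * g x y =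
      (ts.map fun c => g a c.root).sum := by
    rw [Finset.sum_eq_single a]
    · simp only [if_true, sum_count_mul, List.map_map]
      rfl
    · intro b _ hb
      simp [hb.symm]
    · simp
  have h2 : ∑ x, ∑ y, (((ts.map fun c => pairCount c x y).sum : ℕ) : ℝ) * g x y =
      (ts.map (edgeSum g)).sum := by
    clear h1
    induction ts with
    | nil => simp
    | cons c ts ih =>
      simp only [List.map_cons, List.sum_cons, Nat.cast_add, add_mul, Finset.sum_add_distrib, ih]
      rfl
  rw [← h1, ← h2]
  simp only [edgeSum, pairCount_node, Nat.cast_add, add_mul, Finset.sum_add_distrib]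

theorem edgeSum_one (t : PTree 𝒳) : edgeSum (fun _ _ => 1) t = t.size - 1 := by
  induction t using induct with
  | h a ts ih =>
    rw [edgeSum_node, size_node]
    have : (ts.map (edgeSum fun _ _ => 1)).sum = (ts.map fun t => (t.size : ℝ) - 1).sum := by
      rw [List.map_congr_left ih]
    rw [this]
    clear this ih
    induction ts with
    | nil => simp
    | cons c ts ih =>
      simp only [List.map_cons, List.sum_cons, Nat.cast_add, Nat.cast_one] at ih ⊢
      linarith

theorem isProbVec_empPair {t : PTree 𝒳} (ht : 2 ≤ t.size) : IsProbVec (empPair t) := by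
  have h2 : (2 : ℝ) ≤ t.size := by exact_mod_cast ht
  refine ⟨fun x => div_nonneg (Nat.cast_nonneg _) (by linarith), ?_⟩
  have := edgeSum_one t
  simp only [edgeSum, mul_one] at this
  rw [Fintype.sum_prod_type]
  simp only [empPair, ← Finset.sum_div, this]
  exact div_self (by linarith)

theorem sum_empPair_mul (g : 𝒳 → 𝒳 → ℝ) (t : PTree 𝒳) (ht : 2 ≤ t.size) :
    edgeSum g t = (t.size - 1) * ∑ a, ∑ b, empPair t (a, b) * g a b := by
  have h2 : (2 : ℝ) ≤ t.size := by exact_mod_cast ht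
  have h3 : (t.size : ℝ) - 1 ≠ 0 := by linarith
  simp only [edgeSum, Finset.mul_sum, empPair]
  refine Finset.sum_congr rfl fun a _ => Finset.sum_congr rfl fun b _ => ?_
  field_simp

theorem size_modEq {k : ℕ} {Q : 𝒳 → 𝒳 → ℝ} (t : PTree 𝒳) (h : weight k Q t ≠ 0) :
    t.size ≡ 1 [MOD k] := by
  induction t using induct with
  | h a ts ih =>
    obtain ⟨hl, hc⟩ := weight_ne_zero h
    have hs : (ts.map PTree.size).sum ≡ ts.length [MOD k] := by
      clear hl h
      induction ts with
      | nil => rfl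
      | cons c ts ih2 =>
        rw [List.map_cons, List.sum_cons, List.length_cons, add_comm]
        exact (ih2 (fun t ht => ih t (List.mem_cons_of_mem _ ht))
          (fun t ht => hc t (List.mem_cons_of_mem _ ht))).add
          (ih c List.mem_cons_self (hc c List.mem_cons_self).2)
    rw [size_node]
    have h0 : (ts.map PTree.size).sum ≡ 0 [MOD k] := by
      refine hs.trans ?_
      rcases hl with hl | hl
      · rw [hl]; simp [Nat.ModEq]
      · simp [hl, Nat.ModEq]
    simpa using (Nat.ModEq.refl 1).add h0

/-- All typed trees of height at most `H` in which every vertex has `0` or `k` children. -/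
noncomputable def karyTrees (𝒳 : Type*) [Fintype 𝒳] (k : ℕ) : ℕ → Finset (PTree 𝒳)
  | 0 => ∅
  | H + 1 => (Finset.univ.image fun a : 𝒳 => PTree.node a []) ∪
      (Finset.univ ×ˢ Fintype.piFinset fun _ : Fin k => karyTrees 𝒳 k H).image
        fun q : 𝒳 × (Fin k → PTree 𝒳) => PTree.node q.1 (List.ofFn q.2)

theorem mem_karyTrees {k : ℕ} {Q : 𝒳 → 𝒳 → ℝ} (t : PTree 𝒳) (h : weight k Q t ≠ 0) :
    ∀ H, t.size ≤ H → t ∈ karyTrees 𝒳 k H := by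
  induction t using induct with
  | h a ts ih =>
    intro H hH
    rw [size_node] at hH
    obtain ⟨H, rfl⟩ : ∃ H', H = H' + 1 := ⟨H - 1, by omega⟩
    obtain ⟨hl, hc⟩ := weight_ne_zero h
    rw [karyTrees, Finset.mem_union]
    rcases hl with hl | rfl
    · right
      subst hl
      refine Finset.mem_image.2 ⟨(a, fun i => ts.get i), ?_, by simp⟩
      simp only [Finset.mem_product, Finset.mem_univ, true_and, Fintype.mem_piFinset]
      intro i
      have hi : ts.get i ∈ ts := List.get_mem _ _
      refine ih _ hi (hc _ hi).2 _ ?_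
      have := List.single_le_sum (l := ts.map PTree.size) (by simp) _
        (List.mem_map.2 ⟨_, hi, rfl⟩)
      omega
    · left
      exact Finset.mem_image.2 ⟨a, Finset.mem_univ _, rfl⟩

/-- A supersolution `y` of the fixed point equation for tilted weights dominates the tilted
total mass. -/
theorem sum_tilted_le {k : ℕ} (hk : 2 ≤ k) {Q : 𝒳 → 𝒳 → ℝ} (hQ : ∀ a b, 0 ≤ Q a b)
    (g : 𝒳 → 𝒳 → ℝ) (y : 𝒳 → ℝ) (hy0 : ∀ a, 0 ≤ y a)
    (hy : ∀ a, 1 - 1 / (k : ℝ) + 1 / k * (∑ b, Q a b * Real.exp (g a b) * y b) ^ k ≤ y a) :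
    ∀ H a, ∑ t ∈ karyTrees 𝒳 k H with t.root = a, weight k Q t * Real.exp (edgeSum g t) ≤ y a := by
  have hf : ∀ t, 0 ≤ weight k Q t * Real.exp (edgeSum g t) := fun t =>
    mul_nonneg (weight_nonneg hk hQ t) (Real.exp_pos _).le
  intro H
  induction H with
  | zero => intro a; simpa [karyTrees] using hy0 a
  | succ H ih =>
    intro a
    have hsub : (karyTrees 𝒳 k (H + 1)).filter (fun t => t.root = a) ⊆
        {PTree.node a []} ∪ (Fintype.piFinset fun _ : Fin k => karyTrees 𝒳 k H).image
          fun q => PTree.node a (List.ofFn q) := by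
      intro t ht
      rw [Finset.mem_filter, karyTrees, Finset.mem_union] at ht
      obtain ⟨ht | ht, hr⟩ := ht
      · obtain ⟨b, -, rfl⟩ := Finset.mem_image.1 ht
        simp only [PTree.root] at hr
        subst hr
        simp
      · obtain ⟨q, hq, rfl⟩ := Finset.mem_image.1 ht
        simp only [PTree.root] at hr
        subst hr
        refine Finset.mem_union_right _ (Finset.mem_image.2 ⟨q.2, ?_, rfl⟩)
        exact (Finset.mem_product.1 hq).2
    refine (Finset.sum_le_sum_of_subset_of_nonneg hsub fun t _ _ => hf t).trans ?_
    refine (le_add_of_nonneg_right (Finset.sum_nonneg fun t _ => hf t)).trans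
      (Finset.sum_union_inter.le.trans ?_)
    refine le_trans (add_le_add ?_ ?_) (hy a)
    · simp [weight_leaf hk, edgeSum_node]
    · refine (Finset.sum_image_le_of_nonneg (fun t _ => hf t)).trans ?_
      have hsum : ∀ a, ∑ t ∈ karyTrees 𝒳 k H, Q a t.root * Real.exp (g a t.root) *
          (weight k Q t * Real.exp (edgeSum g t)) ≤ ∑ b, Q a b * Real.exp (g a b) * y b := by
        intro a
        rw [← Finset.sum_fiberwise _ PTree.root]
        refine Finset.sum_le_sum fun b _ => ?_
        rw [Finset.sum_congr rfl fun t ht => by rw [(Finset.mem_filter.1 ht).2],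
          ← Finset.mul_sum]
        exact mul_le_mul_of_nonneg_left (ih b) (mul_nonneg (hQ a b) (Real.exp_pos _).le)
      calc _ = ∑ q ∈ Fintype.piFinset fun _ : Fin k => karyTrees 𝒳 k H,
              1 / (k : ℝ) * ∏ i, (Q a (q i).root * Real.exp (g a (q i).root) *
          (weight k Q (q i) * Real.exp (edgeSum g (q i)))) := by
            refine Finset.sum_congr rfl fun q _ => ?_
            rw [weight_node, edgeSum_node, Real.exp_add, Real.exp_list_sum, Real.exp_list_sum]
            simp only [List.length_ofFn, karyLaw_self, List.map_ofFn, List.prod_ofFn,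
              Finset.prod_mul_distrib, Function.comp_apply]
            ring
        _ = 1 / (k : ℝ) * (∑ t ∈ karyTrees 𝒳 k H, Q a t.root * Real.exp (g a t.root) *
          (weight k Q t * Real.exp (edgeSum g t))) ^ k := by
            have := Finset.prod_univ_sum (fun _ : Fin k => karyTrees 𝒳 k H) fun _ t =>
              Q a t.root * Real.exp (g a t.root) * (weight k Q t * Real.exp (edgeSum g t))
            rw [Finset.prod_const, Finset.card_univ, Fintype.card_fin] at this
            rw [← Finset.mul_sum, this]
        _ ≤ _ := by
            gcongr
            · exact Finset.sum_nonneg fun t _ =>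
                mul_nonneg (mul_nonneg (hQ _ _) (Real.exp_pos _).le) (hf t)
            · exact hsum a

open Classical in
/-- The unconditional probability that the tree has `n` vertices and belongs to `E`. -/
noncomputable def mass (k : ℕ) (μ0 : 𝒳 → ℝ) (Q : 𝒳 → 𝒳 → ℝ) (n : ℕ) (E : Set (PTree 𝒳)) : ℝ :=
  ∑ t ∈ karyTrees 𝒳 k n with t.size = n ∧ t ∈ E, jointWeight (karyLaw k) μ0 Q t

open Classical in
theorem tsum_eq_mass {k : ℕ} (hk : 2 ≤ k) {μ0 : 𝒳 → ℝ} (hμ0 : ∀ a, 0 ≤ μ0 a) {Q : 𝒳 → 𝒳 → ℝ}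
    (hQ : ∀ a b, 0 ≤ Q a b) (n : ℕ) (E : Set (PTree 𝒳)) :
    (∑' t : PTree 𝒳, if t.size = n ∧ t ∈ E then
      ENNReal.ofReal (jointWeight (karyLaw k) μ0 Q t) else 0) =
      ENNReal.ofReal (mass k μ0 Q n E) := by
  rw [tsum_eq_sum (s := karyTrees 𝒳 k n), ← Finset.sum_filter, mass,
    ENNReal.ofReal_sum_of_nonneg]
  · intro t _
    exact mul_nonneg (hμ0 _) (weight_nonneg hk hQ t)
  · intro t ht
    split_ifs with h
    · by_cases hw : weight k Q t = 0
      · simp [jointWeight_eq, hw]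
      · exact absurd (mem_karyTrees t hw n h.1.le) ht
    · rfl

open Classical in
theorem treeMass_eq {k : ℕ} (hk : 2 ≤ k) {μ0 : 𝒳 → ℝ} (hμ0 : ∀ a, 0 ≤ μ0 a) {Q : 𝒳 → 𝒳 → ℝ}
    (hQ : ∀ a b, 0 ≤ Q a b) (n : ℕ) :
    treeMass (jointWeight (karyLaw k) μ0 Q) n = ENNReal.ofReal (mass k μ0 Q n Set.univ) := by
  rw [← tsum_eq_mass hk hμ0 hQ]
  simp [treeMass]

theorem condP_eq {k : ℕ} (hk : 2 ≤ k) {μ0 : 𝒳 → ℝ} (hμ0 : ∀ a, 0 ≤ μ0 a) {Q : 𝒳 → 𝒳 → ℝ}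
    (hQ : ∀ a b, 0 ≤ Q a b) (n : ℕ) (E : Set (PTree 𝒳)) :
    condP (jointWeight (karyLaw k) μ0 Q) n E =
      ENNReal.ofReal (mass k μ0 Q n E) / ENNReal.ofReal (mass k μ0 Q n Set.univ) := by
  rw [condP, treeMass_eq hk hμ0 hQ, tsum_eq_mass hk hμ0 hQ]

theorem mass_nonneg {k : ℕ} (hk : 2 ≤ k) {μ0 : 𝒳 → ℝ} (hμ0 : ∀ a, 0 ≤ μ0 a) {Q : 𝒳 → 𝒳 → ℝ}
    (hQ : ∀ a b, 0 ≤ Q a b) (n : ℕ) (E : Set (PTree 𝒳)) : 0 ≤ mass k μ0 Q n E :=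
  Finset.sum_nonneg fun t _ => mul_nonneg (hμ0 _) (weight_nonneg hk hQ t)

theorem mass_union_le {k : ℕ} (hk : 2 ≤ k) {μ0 : 𝒳 → ℝ} (hμ0 : ∀ a, 0 ≤ μ0 a) {Q : 𝒳 → 𝒳 → ℝ}
    (hQ : ∀ a b, 0 ≤ Q a b) (n : ℕ) (E F : Set (PTree 𝒳)) :
    mass k μ0 Q n (E ∪ F) ≤ mass k μ0 Q n E + mass k μ0 Q n F := by
  classical
  have h : ∀ t, 0 ≤ jointWeight (karyLaw k) μ0 Q t := fun t =>
    mul_nonneg (hμ0 _) (weight_nonneg hk hQ t)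
  unfold mass
  refine le_trans ?_ Finset.sum_union_inter.le
  refine (Finset.sum_le_sum_of_subset_of_nonneg ?_ fun t _ _ => h t).trans
    (le_add_of_nonneg_right (Finset.sum_nonneg fun t _ => h t))
  intro t
  simp only [Finset.mem_filter, Finset.mem_union, Set.mem_union]
  tauto

theorem mass_mono {k : ℕ} (hk : 2 ≤ k) {μ0 : 𝒳 → ℝ} (hμ0 : ∀ a, 0 ≤ μ0 a) {Q : 𝒳 → 𝒳 → ℝ}
    (hQ : ∀ a b, 0 ≤ Q a b) {n : ℕ} {E F : Set (PTree 𝒳)}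
    (hEF : ∀ t, t.size = n → t ∈ E → t ∈ F) :
    mass k μ0 Q n E ≤ mass k μ0 Q n F := by
  classical
  refine Finset.sum_le_sum_of_subset_of_nonneg ?_ fun t _ _ =>
    mul_nonneg (hμ0 _) (weight_nonneg hk hQ t)
  exact Finset.monotone_filter_right _ fun t _ ht => ⟨ht.1, hEF t ht.1 ht.2⟩

/-- A family of trees with common size and common lower bound on the weight gives a lower
bound on the mass. -/
theorem card_mul_le_mass {k : ℕ} (hk : 2 ≤ k) {μ0 : 𝒳 → ℝ} (hμ0 : ∀ a, 0 ≤ μ0 a)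
    {Q : 𝒳 → 𝒳 → ℝ} (hQ : ∀ a b, 0 ≤ Q a b) {n : ℕ} {E : Set (PTree 𝒳)} (A : Finset (PTree 𝒳))
    {w : ℝ} (hw : 0 < w) (hA : ∀ t ∈ A, t.size = n ∧ t ∈ E ∧ w ≤ jointWeight (karyLaw k) μ0 Q t) :
    A.card * w ≤ mass k μ0 Q n E := by
  classical
  calc A.card * w = ∑ _t ∈ A, w := by simp
    _ ≤ ∑ t ∈ A, jointWeight (karyLaw k) μ0 Q t := Finset.sum_le_sum fun t ht => (hA t ht).2.2
    _ ≤ _ := by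
      refine Finset.sum_le_sum_of_subset_of_nonneg ?_ fun t _ _ =>
        mul_nonneg (hμ0 _) (weight_nonneg hk hQ t)
      intro t ht
      obtain ⟨h1, h2, h3⟩ := hA t ht
      refine Finset.mem_filter.2 ⟨mem_karyTrees (k := k) (Q := Q) t ?_ n h1.le, h1, h2⟩
      intro h0
      rw [jointWeight_eq, h0, mul_zero] at h3
      linarith

theorem mass_halfSpace_le {k : ℕ} (hk : 2 ≤ k) {μ0 : 𝒳 → ℝ} (hμ0 : ∀ a, 0 ≤ μ0 a)
    {Q : 𝒳 → 𝒳 → ℝ} (hQ : ∀ a b, 0 ≤ Q a b)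
    (g : 𝒳 → 𝒳 → ℝ) (y : 𝒳 → ℝ) (hy0 : ∀ a, 0 ≤ y a)
    (hy : ∀ a, 1 - 1 / (k : ℝ) + 1 / k * (∑ b, Q a b * Real.exp (g a b) * y b) ^ k ≤ y a)
    (n : ℕ) (c : ℝ) :
    mass k μ0 Q n {t | c ≤ edgeSum g t} ≤ (∑ a, μ0 a * y a) * Real.exp (-c) := by
  classical
  have hf : ∀ t, 0 ≤ weight k Q t * Real.exp (edgeSum g t) := fun t =>
    mul_nonneg (weight_nonneg hk hQ t) (Real.exp_pos _).le
  calc mass k μ0 Q n {t | c ≤ edgeSum g t}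
      ≤ ∑ t ∈ karyTrees 𝒳 k n with t.size = n ∧ t ∈ {t | c ≤ edgeSum g t},
        μ0 t.root * (weight k Q t * Real.exp (edgeSum g t)) * Real.exp (-c) := by
        refine Finset.sum_le_sum fun t ht => ?_
        have hc : c ≤ edgeSum g t := (Finset.mem_filter.1 ht).2.2
        rw [jointWeight_eq, mul_assoc, mul_assoc, ← Real.exp_add]
        refine mul_le_mul_of_nonneg_left ?_ (hμ0 _)
        refine le_mul_of_one_le_right (weight_nonneg hk hQ t) (Real.one_le_exp ?_)
        linarith
    _ ≤ ∑ t ∈ karyTrees 𝒳 k n,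
        μ0 t.root * (weight k Q t * Real.exp (edgeSum g t)) * Real.exp (-c) := by
        refine Finset.sum_le_sum_of_subset_of_nonneg (Finset.filter_subset _ _) fun t _ _ => ?_
        exact mul_nonneg (mul_nonneg (hμ0 _) (hf t)) (Real.exp_pos _).le
    _ ≤ _ := by
        rw [← Finset.sum_mul]
        refine mul_le_mul_of_nonneg_right ?_ (Real.exp_pos _).le
        rw [← Finset.sum_fiberwise _ PTree.root]
        refine Finset.sum_le_sum fun a _ => ?_
        rw [Finset.sum_congr rfl fun t ht => by rw [(Finset.mem_filter.1 ht).2], ← Finset.mul_sum]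
        exact mul_le_mul_of_nonneg_left (sum_tilted_le hk hQ g y hy0 hy n a) (hμ0 a)

theorem mass_le_one {k : ℕ} (hk : 2 ≤ k) {μ0 : 𝒳 → ℝ} (hμ0 : ∀ a, 0 ≤ μ0 a)
    (hμ0_sum : ∑ a, μ0 a = 1) {Q : 𝒳 → 𝒳 → ℝ} (hQ : ∀ a b, 0 ≤ Q a b)
    (hQ_sum : ∀ a, ∑ b, Q a b = 1) (n : ℕ) (E : Set (PTree 𝒳)) : mass k μ0 Q n E ≤ 1 := by
  have h := mass_halfSpace_le hk hμ0 hQ (fun _ _ => 0) (fun _ => 1) (by simp)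
    (by simp [hQ_sum]) n 0
  refine (mass_mono hk hμ0 hQ ?_).trans (h.trans ?_)
  · intro t _ _
    simp [edgeSum]
  · simp [hμ0_sum]

/-- The number of words that, read against `z`, have prescribed joint letter counts. -/
theorem exists_words {α β : Type*} [Fintype α] [Fintype β] [DecidableEq α] [DecidableEq β]
    (z : List α) : ∀ J : α → β → ℕ, (∀ a, ∑ b, J a b = z.count a) →
      ∃ T : Finset (List β), (∀ y ∈ T, y.length = z.length ∧
        ∀ a b, (z.zip y).count (a, b) = J a b) ∧
        T.card * ∏ a, ∏ b, (J a b).factorial = ∏ a, (z.count a).factorial := by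
  induction z with
  | nil =>
    intro J hJ
    have h0 : ∀ a b, J a b = 0 := by
      intro a b
      have := hJ a
      simp only [List.count_nil, Finset.sum_eq_zero_iff, Finset.mem_univ, true_imp_iff] at this
      exact this b
    exact ⟨{[]}, by simp [h0], by simp [h0]⟩
  | cons c z ih =>
    intro J hJ
    have hstep : ∀ b : β, ∃ T : Finset (List β), (∀ y ∈ T, J c b ≠ 0 ∧ y.length = z.length ∧
        ∀ a b', (z.zip y).count (a, b') + (if c = a ∧ b = b' then 1 else 0) = J a b') ∧
        T.card * ∏ a, ∏ b, (J a b).factorial = J c b * ∏ a, (z.count a).factorial := by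
      intro b
      by_cases h0 : J c b = 0
      · exact ⟨∅, by simp, by simp [h0]⟩
      obtain ⟨T, hT, hcard⟩ := ih (fun a b' => J a b' - if c = a ∧ b = b' then 1 else 0) (by
        intro a
        have h1 := hJ a
        rw [List.count_cons] at h1
        have h2 : ∑ b', (J a b' - if c = a ∧ b = b' then 1 else 0) +
            ∑ b', (if c = a ∧ b = b' then 1 else 0) = ∑ b', J a b' := by
          rw [← Finset.sum_add_distrib]
          refine Finset.sum_congr rfl fun b' _ => ?_
          split_ifs with h
          · obtain ⟨rfl, rfl⟩ := h; omega
          · omega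
        by_cases hc : c = a
        · subst hc
          simp at h1 h2 ⊢
          omega
        · simp [hc] at h1 h2 ⊢
          omega)
      refine ⟨T, fun y hy => ⟨h0, (hT y hy).1, fun a b' => ?_⟩, ?_⟩
      · rw [(hT y hy).2]
        split_ifs with h
        · obtain ⟨rfl, rfl⟩ := h; omega
        · omega
      · rw [← hcard]
        have hcb : ((c, b) : α × β) ∈ (Finset.univ ×ˢ Finset.univ : Finset (α × β)) := by simp
        have h3 : ∏ a, ∏ b', (J a b').factorial = J c b *
            ∏ a, ∏ b', (J a b' - if c = a ∧ b = b' then 1 else 0).factorial := by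
          rw [← Finset.prod_product', ← Finset.prod_product',
            ← Finset.mul_prod_erase _ _ hcb,
            ← Finset.mul_prod_erase (Finset.univ ×ˢ Finset.univ) _ hcb, ← mul_assoc]
          congr 1
          · simp [Nat.mul_factorial_pred h0]
          · refine Finset.prod_congr rfl fun q hq => ?_
            have : ¬ (c = q.1 ∧ b = q.2) := by
              rintro ⟨rfl, rfl⟩
              exact (Finset.mem_erase.1 hq).1 rfl
            simp [this]
        rw [h3]
        ring
    choose T hT hcard using hstep
    refine ⟨Finset.univ.biUnion fun b => (T b).image (List.cons b), ?_, ?_⟩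
    · intro y hy
      obtain ⟨b, -, hb⟩ := Finset.mem_biUnion.1 hy
      obtain ⟨y', hy', rfl⟩ := Finset.mem_image.1 hb
      obtain ⟨-, h1, h2⟩ := hT b y' hy'
      refine ⟨by simp [h1], fun a b' => ?_⟩
      rw [← h2, List.zip_cons_cons, List.count_cons]
      simp
    · rw [Finset.card_biUnion]
      · have : ∀ b, ((T b).image (List.cons b)).card = (T b).card := fun b =>
          Finset.card_image_of_injective _ List.cons_injective
        simp only [this]
        rw [Finset.sum_mul, Finset.sum_congr rfl fun b _ => hcard b, ← Finset.sum_mul, hJ c]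
        rw [← Finset.mul_prod_erase _ _ (Finset.mem_univ c),
          ← Finset.mul_prod_erase _ (fun a => ((c :: z).count a).factorial) (Finset.mem_univ c)]
        rw [← mul_assoc, List.count_cons_self, Nat.factorial_succ]
        congr 1
        refine Finset.prod_congr rfl fun a ha => ?_
        rw [List.count_cons_of_ne (Finset.mem_erase.1 ha).1.symm]
      · intro b _ b' _ hbb
        rw [Function.onFun, Finset.disjoint_left]
        intro y hy hy'
        obtain ⟨y1, -, rfl⟩ := Finset.mem_image.1 hy
        obtain ⟨y2, -, h⟩ := Finset.mem_image.1 hy'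
        exact hbb (List.cons.inj h).1.symm

theorem prod_map_eq_prod_pow_count {α : Type*} [Fintype α] [BEq α] [LawfulBEq α] (l : List α)
    (f : α → ℝ) : (l.map f).prod = ∏ a, f a ^ l.count a := by
  classical
  induction l with
  | nil => simp
  | cons b l ih =>
    simp only [List.map_cons, List.prod_cons, ih, List.count_cons, pow_add,
      Finset.prod_mul_distrib]
    simp [mul_comm, pow_ite]

theorem sum_count_zip_left {α β : Type*} [Fintype α] [DecidableEq α] [DecidableEq β]
    (z : List α) : ∀ y : List β, z.length = y.length → ∀ b,
      y.count b = ∑ a, (z.zip y).count (a, b) := by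
  induction z with
  | nil => intro y hy b; simp [List.length_eq_zero_iff.1 hy.symm]
  | cons c z ih =>
    intro y hy b
    match y, hy with
    | d :: y, hy =>
      rw [List.count_cons, ih y (by simpa using hy) b]
      simp only [List.zip_cons_cons, List.count_cons, Finset.sum_add_distrib]
      congr 1
      by_cases h : d = b <;> simp [h]

/-- Attach a forest below a row of vertices; each flagged vertex receives the next `k` trees. -/
def graft {α : Type*} (k : ℕ) : List (α × Bool) → List (PTree α) → List (PTree α)
  | [], _ => []
  | (a, false) :: s, f => PTree.node a [] :: graft k s f
  | (a, true) :: s, f => PTree.node a (f.take k) :: graft k s (f.drop k)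

/-- The types of the parents of the vertices in the next row. -/
def parents {α : Type*} (k : ℕ) : List (α × Bool) → List α
  | [] => []
  | (_, false) :: s => parents k s
  | (a, true) :: s => List.replicate k a ++ parents k s

theorem graft_root {α : Type*} (k : ℕ) (s : List (α × Bool)) :
    ∀ f, (graft k s f).map PTree.root = s.map Prod.fst := by
  induction s with
  | nil => intro f; rfl
  | cons q s ih =>
    intro f
    obtain ⟨a, _ | _⟩ := q <;> simp [graft, ih, PTree.root]

theorem graft_children {α : Type*} (k : ℕ) (s : List (α × Bool)) :
    ∀ f, f.length = (parents k s).length → (graft k s f).flatMap PTree.children = f := by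
  induction s with
  | nil => intro f hf; simpa [graft, parents, eq_comm] using hf
  | cons q s ih =>
    intro f hf
    obtain ⟨a, _ | _⟩ := q
    · simpa [graft, PTree.children] using ih f hf
    · have := ih (f.drop k) (by simp [parents] at hf ⊢; omega)
      simp [graft, PTree.children, this]

theorem graft_flags {α : Type*} {k : ℕ} (hk : 2 ≤ k) (s : List (α × Bool)) :
    ∀ f, f.length = (parents k s).length →
      (graft k s f).map (fun t => !t.children.isEmpty) = s.map Prod.snd := by
  induction s with
  | nil => intro f _; rfl
  | cons q s ih =>
    intro f hf
    obtain ⟨a, _ | _⟩ := q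
    · simpa [graft, PTree.children] using ih f hf
    · have := ih (f.drop k) (by simp [parents] at hf ⊢; omega)
      have hf0 : f ≠ [] := by
        rintro rfl
        simp [parents] at hf
        omega
      have hk0 : k ≠ 0 := by omega
      simp only [graft, List.map_cons, this]
      simp [PTree.children, hf0, hk0]

theorem graft_pairCount (k : ℕ) (s : List (𝒳 × Bool)) (x y : 𝒳) :
    ∀ f, f.length = (parents k s).length →
      ((graft k s f).map fun t => pairCount t x y).sum =
        ((parents k s).zip (f.map PTree.root)).count (x, y) +
          (f.map fun t => pairCount t x y).sum := by
  induction s with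
  | nil => intro f hf; simp [graft, List.length_eq_zero_iff.1 hf]
  | cons q s ih =>
    intro f hf
    obtain ⟨a, _ | _⟩ := q
    · simpa [graft, pairCount_node, parents] using ih f hf
    · have h := ih (f.drop k) (by simp [parents] at hf ⊢; omega)
      have hl : (f.take k).length = k := by simp [parents] at hf ⊢; omega
      have hz : ∀ (m : ℕ) (l : List 𝒳), l.length = m →
          ((List.replicate m a).zip l).count (x, y) = if a = x then l.count y else 0 := by
        intro m l hm
        subst hm
        induction l with
        | nil => simp
        | cons b l ihl =>
          rw [List.length_cons, List.replicate_succ, List.zip_cons_cons, List.count_cons, ihl,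
            List.count_cons]
          by_cases hax : a = x <;> simp [hax]
      conv_rhs => rw [← List.take_append_drop k f]
      simp only [graft, parents, List.map_cons, List.sum_cons, List.map_append, List.sum_append]
      rw [List.zip_append (by simpa using hl.symm), List.count_append, h, pairCount_node,
        hz k _ (by simpa using hl)]
      omega

theorem graft_size (k : ℕ) {α : Type*} (s : List (α × Bool)) :
    ∀ f, f.length = (parents k s).length →
      ((graft k s f).map PTree.size).sum = s.length + (f.map PTree.size).sum := by
  induction s with
  | nil => intro f hf; simp [graft, List.length_eq_zero_iff.1 hf]
  | cons q s ih =>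
    intro f hf
    obtain ⟨a, _ | _⟩ := q
    · have := ih f hf
      simp [graft, size_node, this]
      omega
    · have h := ih (f.drop k) (by simp [parents] at hf ⊢; omega)
      conv_rhs => rw [← List.take_append_drop k f]
      simp only [graft, List.map_cons, List.sum_cons, List.map_append, List.sum_append, h,
        size_node, List.length_cons]
      omega

theorem graft_weight (k : ℕ) (Q : 𝒳 → 𝒳 → ℝ) (s : List (𝒳 × Bool)) :
    ∀ f, f.length = (parents k s).length →
      ((graft k s f).map (weight k Q)).prod =
        (s.map fun q => karyLaw k (if q.2 then k else 0)).prod *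
        (((parents k s).zip (f.map PTree.root)).map fun q => Q q.1 q.2).prod *
          (f.map (weight k Q)).prod := by
  induction s with
  | nil => intro f hf; simp [graft, List.length_eq_zero_iff.1 hf]
  | cons q s ih =>
    intro f hf
    obtain ⟨a, _ | _⟩ := q
    · have := ih f hf
      simp [graft, weight_node, this, parents]
      ring
    · have h := ih (f.drop k) (by simp [parents] at hf ⊢; omega)
      have hl : (f.take k).length = k := by simp [parents] at hf ⊢; omega
      have hz : ∀ (m : ℕ) (l : List (PTree 𝒳)), l.length = m →
          (((List.replicate m a).zip (l.map PTree.root)).map fun q => Q q.1 q.2).prod =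
            (l.map fun c => Q a c.root).prod := by
        intro m l hm
        subst hm
        induction l with
        | nil => simp
        | cons b l ihl => simp [List.replicate_succ, ihl]
      conv_rhs => rw [← List.take_append_drop k f]
      simp only [graft, parents, List.map_cons, List.prod_cons, List.map_append, List.prod_append]
      rw [List.zip_append (by simpa using hl.symm), List.map_append, List.prod_append, h,
        weight_node, hz k _ hl, hl]
      simp only [if_true]
      ring

theorem parents_count {α : Type*} [DecidableEq α] (k : ℕ) (s : List (α × Bool)) (a : α) :
    (parents k s).count a = k * s.count (a, true) := by
  induction s with
  | nil => simp [parents]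
  | cons q s ih =>
    obtain ⟨b, _ | _⟩ := q
    · simp [parents, ih]
    · simp only [parents, List.count_append, ih, List.count_replicate, List.count_cons]
      by_cases h : b = a
      · simp [h]; ring
      · simp [h]

/-- The number of ways to pass from a row of vertices to the next one when `J a b` edges lead from
type `a` to type `b`, `M a` vertices of type `a` have children, and both rows have
`∑ b, J b a` vertices of type `a`. -/
noncomputable def rowCount (J : 𝒳 → 𝒳 → ℕ) (M : 𝒳 → ℕ) : ℝ :=
  (∏ a, ((∑ b, J b a).factorial : ℝ) / ((M a).factorial * (∑ b, J b a - M a).factorial)) *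
    ∏ a, ((∑ b, J a b).factorial : ℝ) / ∏ b, ((J a b).factorial : ℝ)

/-- The weight contributed by one row. -/
noncomputable def rowWeight (k : ℕ) (Q : 𝒳 → 𝒳 → ℝ) (J : 𝒳 → 𝒳 → ℕ) (M : 𝒳 → ℕ) : ℝ :=
  (∏ a, (1 / (k : ℝ)) ^ M a * (1 - 1 / (k : ℝ)) ^ (∑ b, J b a - M a)) *
    ∏ a, ∏ b, Q a b ^ J a b

theorem length_eq_sum_count {α : Type*} [Fintype α] [DecidableEq α] (l : List α) :
    l.length = ∑ a, l.count a := by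
  rw [← Multiset.coe_card, ← Multiset.sum_count_eq_card (s := Finset.univ) (by simp)]
  simp

theorem exists_forests {k : ℕ} (hk : 2 ≤ k) (Q : 𝒳 → 𝒳 → ℝ) {J : 𝒳 → 𝒳 → ℕ} {M : 𝒳 → ℕ}
    (hM : ∀ a, ∑ b, J a b = k * M a) (hle : ∀ a, M a ≤ ∑ b, J b a) :
    ∀ (g : ℕ) (x : List 𝒳), (∀ a, x.count a = ∑ b, J b a) →
      ∃ F : Finset (List (PTree 𝒳)), (F.card : ℝ) = rowCount J M ^ g ∧
        ∀ f ∈ F, f.map PTree.root = x ∧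
          (∀ a b, (f.map fun t => pairCount t a b).sum = g * J a b) ∧
          (f.map PTree.size).sum = (g + 1) * x.length ∧
          (f.map (weight k Q)).prod = (1 - 1 / (k : ℝ)) ^ x.length * rowWeight k Q J M ^ g := by
  intro g
  induction g with
  | zero =>
    intro x _
    refine ⟨{x.map fun a => PTree.node a []}, by simp, ?_⟩
    intro f hf
    rw [Finset.mem_singleton] at hf
    subst hf
    simp only [List.map_map, Function.comp_def, pairCount_node, size_node, weight_leaf hk,
      PTree.root]
    simp
  | succ g ih =>
    intro x hx
    obtain ⟨T₁, hT₁, hc₁⟩ := exists_words x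
      (fun a (e : Bool) => if e then M a else ∑ b, J b a - M a) (by
        intro a
        have := hle a
        simp [hx a]
        omega)
    have hpar : ∀ l ∈ T₁, ∀ a, (parents k (x.zip l)).count a = ∑ b, J a b := by
      intro l hl a
      rw [parents_count, (hT₁ l hl).2, hM]
      simp
    have hT₂ : ∀ l : List Bool, ∃ T : Finset (List 𝒳), l ∈ T₁ → (∀ y ∈ T,
        y.length = (parents k (x.zip l)).length ∧
        ∀ a b, ((parents k (x.zip l)).zip y).count (a, b) = J a b) ∧
        T.card * ∏ a, ∏ b, (J a b).factorial = ∏ a, (∑ b, J a b).factorial := by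
      intro l
      by_cases hl : l ∈ T₁
      · obtain ⟨T, h1, h2⟩ := exists_words (parents k (x.zip l)) J fun a => (hpar l hl a).symm
        refine ⟨T, fun _ => ⟨h1, ?_⟩⟩
        rw [h2]
        exact Finset.prod_congr rfl fun a _ => by rw [hpar l hl a]
      · exact ⟨∅, fun h => absurd h hl⟩
    choose T₂ hT₂ using hT₂
    have hF : ∀ y : List 𝒳, ∃ F : Finset (List (PTree 𝒳)),
        (∀ a, y.count a = ∑ b, J b a) → (F.card : ℝ) = rowCount J M ^ g ∧
        ∀ f ∈ F, f.map PTree.root = y ∧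
          (∀ a b, (f.map fun t => pairCount t a b).sum = g * J a b) ∧
          (f.map PTree.size).sum = (g + 1) * y.length ∧
          (f.map (weight k Q)).prod =
            (1 - 1 / (k : ℝ)) ^ y.length * rowWeight k Q J M ^ g := by
      intro y
      by_cases hy : ∀ a, y.count a = ∑ b, J b a
      · obtain ⟨F, hF⟩ := ih y hy
        exact ⟨F, fun _ => hF⟩
      · exact ⟨∅, fun h => absurd h hy⟩
    choose F hF using hF
    have hycount : ∀ l ∈ T₁, ∀ y ∈ T₂ l, ∀ a, y.count a = ∑ b, J b a := by
      intro l hl y hy a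
      obtain ⟨h1, h2⟩ := (hT₂ l hl).1 y hy
      rw [sum_count_zip_left _ y h1.symm a]
      exact Finset.sum_congr rfl fun b _ => h2 b a
    have hlen : ∀ l ∈ T₁, ∀ y ∈ T₂ l, ∀ f ∈ F y, f.length = (parents k (x.zip l)).length := by
      intro l hl y hy f hf
      rw [← ((hT₂ l hl).1 y hy).1, ← ((hF y (hycount l hl y hy)).2 f hf).1, List.length_map]
    let S : Finset (Σ _ : List Bool, Σ _ : List 𝒳, List (PTree 𝒳)) :=
      T₁.sigma fun l => (T₂ l).sigma fun y => F y
    have hS : ∀ q ∈ S, q.1 ∈ T₁ ∧ q.2.1 ∈ T₂ q.1 ∧ q.2.2 ∈ F q.2.1 := by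
      intro q hq
      obtain ⟨h1, h2⟩ := Finset.mem_sigma.1 hq
      obtain ⟨h3, h4⟩ := Finset.mem_sigma.1 h2
      exact ⟨h1, h3, h4⟩
    refine ⟨S.image fun q => graft k (x.zip q.1) q.2.2, ?_, ?_⟩
    · rw [Finset.card_image_of_injOn]
      · have hc₂ : ∀ l ∈ T₁, ((T₂ l).card : ℝ) =
            ∏ a, ((∑ b, J a b).factorial : ℝ) / ∏ b, ((J a b).factorial : ℝ) := by
          intro l hl
          have := (hT₂ l hl).2
          rw [Finset.prod_div_distrib, eq_div_iff]
          · exact_mod_cast this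
          · exact Finset.prod_ne_zero_iff.2 fun a _ => Finset.prod_ne_zero_iff.2 fun b _ =>
              Nat.cast_ne_zero.2 (Nat.factorial_ne_zero _)
        have hc₁' : (T₁.card : ℝ) = ∏ a, ((∑ b, J b a).factorial : ℝ) /
            ((M a).factorial * (∑ b, J b a - M a).factorial) := by
          rw [Finset.prod_div_distrib, eq_div_iff]
          · simp only [Fintype.prod_bool, hx] at hc₁
            exact_mod_cast hc₁
          · exact Finset.prod_ne_zero_iff.2 fun a _ => mul_ne_zero
              (Nat.cast_ne_zero.2 (Nat.factorial_ne_zero _))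
              (Nat.cast_ne_zero.2 (Nat.factorial_ne_zero _))
        rw [Finset.card_sigma, Nat.cast_sum, Finset.sum_congr rfl fun l hl => by
          rw [Finset.card_sigma, Nat.cast_sum, Finset.sum_congr rfl fun y hy =>
            (hF y (hycount l hl y hy)).1, Finset.sum_const, nsmul_eq_mul, hc₂ l hl]]
        rw [Finset.sum_const, nsmul_eq_mul, hc₁', pow_succ, rowCount]
        ring
      · rintro ⟨l, y, f⟩ hq ⟨l', y', f'⟩ hq' h
        obtain ⟨h1, h2, h3⟩ := hS _ hq
        obtain ⟨h1', h2', h3'⟩ := hS _ hq'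
        simp only at h h1 h2 h3 h1' h2' h3'
        have hf : f = f' := by
          rw [← graft_children k _ f (hlen l h1 y h2 f h3), h,
            graft_children k _ f' (hlen l' h1' y' h2' f' h3')]
        have hl : l = l' := by
          rw [← List.map_snd_zip (l₁ := x) (hT₁ l h1).1.le,
            ← graft_flags hk _ f (hlen l h1 y h2 f h3), h,
            graft_flags hk _ f' (hlen l' h1' y' h2' f' h3'),
            List.map_snd_zip (l₁ := x) (hT₁ l' h1').1.le]
        have hy : y = y' := by
          rw [← ((hF y (hycount l h1 y h2)).2 f h3).1, hf,
            ((hF y' (hycount l' h1' y' h2')).2 f' h3').1]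
        rw [hl, hy, hf]
    · intro f hf
      obtain ⟨⟨l, y, f⟩, hq, rfl⟩ := Finset.mem_image.1 hf
      obtain ⟨h1, h2, h3⟩ := hS _ hq
      simp only at h1 h2 h3
      have hl := hlen l h1 y h2 f h3
      obtain ⟨hr, hp, hs, hw⟩ := (hF y (hycount l h1 y h2)).2 f h3
      have hxy : y.length = x.length := by
        rw [length_eq_sum_count, length_eq_sum_count x]
        exact Finset.sum_congr rfl fun a _ => by rw [hycount l h1 y h2, hx]
      have hzl : (x.zip l).length = x.length := by
        rw [List.length_zip, (hT₁ l h1).1, min_self]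
      refine ⟨?_, fun a b => ?_, ?_, ?_⟩
      · rw [graft_root, List.map_fst_zip (hT₁ l h1).1.ge]
      · rw [graft_pairCount k _ a b f hl, hp, hr, ((hT₂ l h1).1 y h2).2]
        ring
      · rw [graft_size k _ f hl, hs, hxy, hzl]
        ring
      · rw [graft_weight k Q _ f hl, hw, hr, hxy, prod_map_eq_prod_pow_count,
          prod_map_eq_prod_pow_count, Fintype.prod_prod_type, Fintype.prod_prod_type]
        simp only [(hT₁ l h1).2, ((hT₂ l h1).1 y h2).2, Fintype.prod_bool, if_true,
          Bool.false_eq_true, if_false, karyLaw_self, karyLaw_zero hk]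
        rw [pow_succ, rowWeight]
        ring

theorem root_node {α : Type*} (a : α) (ts : List (PTree α)) : (PTree.node a ts).root = a := rfl

/-- There is a fixed partial tree of positive weight with root type `r` into which every forest with
root types `x` can be planted. -/
def Plantable (k : ℕ) (Q : 𝒳 → 𝒳 → ℝ) (r : 𝒳) (x : List 𝒳) : Prop :=
  ∃ (C : List (PTree 𝒳) → PTree 𝒳) (N : 𝒳 → 𝒳 → ℕ) (s : ℕ) (w : ℝ), 0 < w ∧
    Set.InjOn C {f | f.map PTree.root = x} ∧
    ∀ f, f.map PTree.root = x → (C f).root = r ∧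
      (∀ a b, pairCount (C f) a b = N a b + (f.map fun t => pairCount t a b).sum) ∧
      (C f).size = s + (f.map PTree.size).sum ∧
      weight k Q (C f) = w * (f.map (weight k Q)).prod

theorem plantable_singleton (k : ℕ) (Q : 𝒳 → 𝒳 → ℝ) (r : 𝒳) : Plantable k Q r [r] := by
  refine ⟨fun f => f.headD (PTree.node r []), 0, 0, 1, one_pos, ?_, ?_⟩
  · intro f hf f' hf' h
    obtain ⟨t, rfl, -⟩ := List.map_eq_singleton_iff.1 hf
    obtain ⟨t', rfl, -⟩ := List.map_eq_singleton_iff.1 hf'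
    simpa using h
  · intro f hf
    obtain ⟨t, rfl, ht⟩ := List.map_eq_singleton_iff.1 hf
    simp [ht]

theorem plantable_nil {k : ℕ} (hk : 2 ≤ k) (Q : 𝒳 → 𝒳 → ℝ) (r : 𝒳) : Plantable k Q r [] := by
  refine ⟨fun _ => PTree.node r [], 0, 1, 1 - 1 / k, karyLaw_zero_pos hk, ?_, ?_⟩
  · intro f hf f' hf' _
    rw [List.map_eq_nil_iff.1 hf, List.map_eq_nil_iff.1 hf']
  · intro f hf
    simp [List.map_eq_nil_iff.1 hf, PTree.root, pairCount_node, size_node, weight_leaf hk]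

theorem Plantable.step {k : ℕ} (hk : 2 ≤ k) {Q : 𝒳 → 𝒳 → ℝ} {r b : 𝒳} {x : List 𝒳}
    (hQ : 0 < Q r b) (h : Plantable k Q b x) : Plantable k Q r x := by
  obtain ⟨C, N, s, w, hw, hC, hf⟩ := h
  have hp := karyLaw_zero_pos hk
  have hk0 : (0 : ℝ) < k := by positivity
  refine ⟨fun f => PTree.node r (C f :: List.replicate (k - 1) (PTree.node b [])),
    fun a c => (if r = a then (List.replicate k b).count c else 0) + N a c,
    1 + s + (k - 1), 1 / k * (Q r b) ^ k * w * (1 - 1 / (k : ℝ)) ^ (k - 1), by positivity,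
    ?_, ?_⟩
  · intro f hf f' hf' h
    simp only [PTree.node.injEq, true_and, List.cons.injEq, and_true] at h
    exact hC hf hf' h
  · intro f hfx
    obtain ⟨h1, h2, h3, h4⟩ := hf f hfx
    obtain ⟨m, rfl⟩ : ∃ m, k = m + 1 := ⟨k - 1, by omega⟩
    refine ⟨rfl, fun a c => ?_, ?_, ?_⟩
    · rw [pairCount_node]
      simp only [List.map_cons, List.map_replicate, h1, h2, root_node, List.sum_cons,
        List.replicate_succ, Nat.add_sub_cancel]
      simp [pairCount_node]
      ring
    · rw [size_node]
      simp [h3, size_node]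
      ring
    · rw [weight_node]
      simp only [List.length_cons, List.length_replicate, Nat.add_sub_cancel, karyLaw_self,
        List.map_cons, List.map_replicate, List.prod_cons, List.prod_replicate, h1, h4, root_node,
        weight_leaf hk]
      ring

theorem Plantable.branch {k : ℕ} (hk : 2 ≤ k) {Q : 𝒳 → 𝒳 → ℝ} {r b a : 𝒳} {x : List 𝒳}
    (hQ : 0 < Q r b) (h : Plantable k Q b [a]) (h' : Plantable k Q b x) :
    Plantable k Q r (a :: x) := by
  obtain ⟨C, N, s, w, hw, hC, hf⟩ := h
  obtain ⟨C', N', s', w', hw', hC', hf'⟩ := h'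
  have hp := karyLaw_zero_pos hk
  have hk0 : (0 : ℝ) < k := by positivity
  refine ⟨fun f => PTree.node r (C (f.take 1) :: C' (f.drop 1) ::
      List.replicate (k - 2) (PTree.node b [])),
    fun d c => (if r = d then (List.replicate k b).count c else 0) + N d c + N' d c,
    1 + s + s' + (k - 2), 1 / k * (Q r b) ^ k * w * w' * (1 - 1 / (k : ℝ)) ^ (k - 2),
    by positivity, ?_, ?_⟩
  · intro f hf f' hf' h
    obtain ⟨t, g, rfl, ht, hg⟩ := List.map_eq_cons_iff.1 hf
    obtain ⟨t', g', rfl, ht', hg'⟩ := List.map_eq_cons_iff.1 hf'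
    simp only [PTree.node.injEq, true_and, List.cons.injEq, and_true, List.take_succ_cons,
      List.take_zero, List.drop_succ_cons, List.drop_zero] at h
    have h1 := hC (x₁ := [t]) (x₂ := [t']) (by simp [ht]) (by simp [ht']) h.1
    rw [hC' hg hg' h.2, (List.cons.inj h1).1]
  · intro f hfx
    obtain ⟨t, g, rfl, ht, hg⟩ := List.map_eq_cons_iff.1 hfx
    obtain ⟨h1, h2, h3, h4⟩ := hf [t] (by simp [ht])
    obtain ⟨h1', h2', h3', h4'⟩ := hf' g hg
    obtain ⟨m, rfl⟩ : ∃ m, k = m + 2 := ⟨k - 2, by omega⟩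
    simp only [List.take_succ_cons, List.take_zero, List.drop_succ_cons, List.drop_zero]
    refine ⟨rfl, fun d c => ?_, ?_, ?_⟩
    · rw [pairCount_node]
      simp only [List.map_cons, List.map_replicate, h1, h2, h1', h2', root_node, List.sum_cons,
        List.replicate_succ, Nat.add_sub_cancel]
      simp [pairCount_node]
      ring
    · rw [size_node]
      simp [h3, h3', size_node]
      ring
    · rw [weight_node]
      simp only [List.length_cons, List.length_replicate, Nat.add_sub_cancel, karyLaw_self,
        List.map_cons, List.map_replicate, List.prod_cons, List.prod_replicate, h1, h4, h1', h4',
        root_node, weight_leaf hk, List.map_nil, List.prod_nil]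
      ring

theorem plantable_of_pow_pos {k : ℕ} (hk : 2 ≤ k) {Q : 𝒳 → 𝒳 → ℝ} (hQ : ∀ a b, 0 ≤ Q a b)
    (m : ℕ) : ∀ a b, 0 < ((Matrix.of Q) ^ m) a b → Plantable k Q a [b] := by
  induction m with
  | zero =>
    intro a b h
    rw [pow_zero, Matrix.one_apply] at h
    split_ifs at h with hab
    · exact hab ▸ plantable_singleton k Q a
    · exact absurd h (lt_irrefl _)
  | succ m ih =>
    intro a b h
    rw [pow_succ', Matrix.mul_apply] at h
    obtain ⟨c, -, hc⟩ := Finset.exists_lt_of_sum_lt (s := Finset.univ)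
      (f := fun _ : 𝒳 => (0 : ℝ)) (by simpa using h)
    have h1 : 0 < Q a c := lt_of_le_of_ne (hQ a c) fun h0 => by
      rw [← h0, zero_mul] at hc; exact lt_irrefl _ hc
    exact (ih c b (pos_of_mul_pos_right hc h1.le)).step hk h1

theorem exists_pos_transition {Q : 𝒳 → 𝒳 → ℝ} (hQ_sum : ∀ a, ∑ b, Q a b = 1) (a : 𝒳) :
    ∃ b, 0 < Q a b := by
  obtain ⟨b, -, hb⟩ := Finset.exists_lt_of_sum_lt (s := Finset.univ)
      (f := fun _ : 𝒳 => (0 : ℝ)) (g := Q a) (by simp [hQ_sum])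
  exact ⟨b, hb⟩

theorem plantable {k : ℕ} (hk : 2 ≤ k) {Q : 𝒳 → 𝒳 → ℝ} (hQ : ∀ a b, 0 ≤ Q a b)
    (hQ_sum : ∀ a, ∑ b, Q a b = 1)
    (hQ_irr : ∀ a b, ∃ m : ℕ, 0 < ((Matrix.of Q) ^ (m + 1)) a b) (x : List 𝒳) :
    ∀ r, Plantable k Q r x := by
  induction x with
  | nil => exact plantable_nil hk Q
  | cons a x ih =>
    intro r
    obtain ⟨b, hb⟩ := exists_pos_transition hQ_sum r
    obtain ⟨m, hm⟩ := hQ_irr b a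
    exact Plantable.branch hk hb (plantable_of_pow_pos hk hQ _ _ _ hm) (ih b)

theorem exists_chain {k : ℕ} (hk : 2 ≤ k) {Q : 𝒳 → 𝒳 → ℝ}
    (hQ_sum : ∀ a, ∑ b, Q a b = 1) (q : ℕ) :
    ∀ a, ∃ t : PTree 𝒳, t.root = a ∧ t.size = 1 + k * q ∧ 0 < weight k Q t := by
  have hp := karyLaw_zero_pos hk
  induction q with
  | zero =>
    intro a
    exact ⟨PTree.node a [], rfl, by simp [size_node], by rw [weight_leaf hk]; exact hp⟩
  | succ q ih =>
    intro a
    obtain ⟨b, hb⟩ := exists_pos_transition hQ_sum a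
    obtain ⟨t, h1, h2, h3⟩ := ih b
    refine ⟨PTree.node a (t :: List.replicate (k - 1) (PTree.node b [])), rfl, ?_, ?_⟩
    · rw [size_node]
      obtain ⟨m, rfl⟩ : ∃ m, k = m + 1 := ⟨k - 1, by omega⟩
      simp [size_node, h2]
      ring
    · have hk0 : (0 : ℝ) < k := by positivity
      rw [weight_node]
      have : (t :: List.replicate (k - 1) (PTree.node b [])).length = k := by simp; omega
      rw [this, karyLaw_self]
      simp only [List.map_cons, List.map_replicate, List.prod_cons, List.prod_replicate, h1,
        root_node, weight_leaf hk]
      positivity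

theorem pairCount_le_size (t : PTree 𝒳) (a b : 𝒳) : pairCount t a b ≤ t.size := by
  have h := edgeSum_one t
  simp only [edgeSum, mul_one] at h
  have h1 : (pairCount t a b : ℝ) ≤ ∑ b, (pairCount t a b : ℝ) :=
    Finset.single_le_sum (f := fun b => (pairCount t a b : ℝ)) (fun _ _ => Nat.cast_nonneg _)
      (Finset.mem_univ b)
  have h2 : ∑ b, (pairCount t a b : ℝ) ≤ ∑ a, ∑ b, (pairCount t a b : ℝ) :=
    Finset.single_le_sum (f := fun a => ∑ b, (pairCount t a b : ℝ))
      (fun _ _ => Finset.sum_nonneg fun _ _ => Nat.cast_nonneg _) (Finset.mem_univ a)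
  have : (pairCount t a b : ℝ) ≤ t.size := by linarith
  exact_mod_cast this

theorem exists_list_count {α : Type*} [Fintype α] [DecidableEq α] (v : α → ℕ) :
    ∃ x : List α, ∀ a, x.count a = v a := by
  refine ⟨(∑ a, Multiset.replicate (v a) a).toList, fun a => ?_⟩
  rw [← Multiset.coe_count, Multiset.coe_toList, Multiset.count_sum']
  simp [Multiset.count_replicate]

/-- Many trees of size `n` with edge counts close to a multiple of a given stationary matrix. -/
theorem exists_trees {k : ℕ} (hk : 2 ≤ k) {μ0 : 𝒳 → ℝ} {Q : 𝒳 → 𝒳 → ℝ} (hQ : ∀ a b, 0 ≤ Q a b)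
    (hQ_sum : ∀ a, ∑ b, Q a b = 1)
    (hQ_irr : ∀ a b, ∃ m : ℕ, 0 < ((Matrix.of Q) ^ (m + 1)) a b) {r : 𝒳} (hr : 0 < μ0 r)
    {J : 𝒳 → 𝒳 → ℕ} {M : 𝒳 → ℕ} (hM : ∀ a, ∑ b, J a b = k * M a)
    (hle : ∀ a, M a ≤ ∑ b, J b a) (hJQ : ∀ a b, 0 < J a b → 0 < Q a b)
    (hV : 0 < ∑ a, ∑ b, J a b) :
    ∃ (B : ℕ) (w : ℝ), 0 < w ∧ ∀ n, B ≤ n → n ≡ 1 [MOD k] → ∃ (g : ℕ) (A : Finset (PTree 𝒳)),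
      g * (∑ a, ∑ b, J a b) ≤ n ∧ n ≤ g * (∑ a, ∑ b, J a b) + B ∧
      (A.card : ℝ) = rowCount J M ^ g ∧ ∀ t ∈ A, t.size = n ∧
        (∀ a b, g * J a b ≤ pairCount t a b ∧ pairCount t a b ≤ g * J a b + B) ∧
        w * rowWeight k Q J M ^ g ≤ jointWeight (karyLaw k) μ0 Q t := by
  have hp := karyLaw_zero_pos hk
  set V := ∑ a, ∑ b, J a b with hVdef
  obtain ⟨x, hx⟩ := exists_list_count fun a => ∑ b, J b a
  have hxV : x.length = V := by
    rw [length_eq_sum_count]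
    simp only [hx]
    exact Finset.sum_comm
  have hkV : k ∣ V := by
    rw [hVdef]
    exact Finset.dvd_sum fun a _ => ⟨M a, hM a⟩
  obtain ⟨C, N, s, w, hw, hC, hf⟩ := plantable hk hQ hQ_sum hQ_irr (r :: x) r
  choose τ hτr hτs hτw using fun q => exists_chain hk hQ_sum q r
  have hω : 0 < rowWeight k Q J M := by
    have hk0 : (0 : ℝ) < k := by positivity
    refine mul_pos (Finset.prod_pos fun a _ => by positivity)
      (Finset.prod_pos fun a _ => Finset.prod_pos fun b _ => ?_)
    rcases Nat.eq_zero_or_pos (J a b) with h | h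
    · simp [h]
    · exact pow_pos (hJQ a b h) _
  have hs : k ∣ s := by
    obtain ⟨h1, -, h3, h4⟩ := hf (τ 0 :: x.map fun a => PTree.node a []) (by
      simp [hτr, Function.comp_def, root_node])
    have hne : weight k Q (C (τ 0 :: x.map fun a => PTree.node a [])) ≠ 0 := by
      rw [h4, List.map_cons, List.prod_cons, List.map_map]
      refine mul_ne_zero hw.ne' (mul_ne_zero (hτw 0).ne' ?_)
      simp only [Function.comp_def, weight_leaf hk, List.map_const', List.prod_replicate]
      exact pow_ne_zero _ hp.ne'
    have h5 := size_modEq _ hne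
    rw [h3] at h5
    simp only [List.map_cons, hτs, List.map_map, Function.comp_def, size_node, List.map_nil,
      List.sum_nil, List.sum_cons, List.map_const', List.sum_replicate, smul_eq_mul, hxV] at h5
    have h6 : s + V ≡ 0 [MOD k] := by
      refine Nat.ModEq.add_right_cancel' 1 ?_
      convert h5 using 1
      ring
    rw [Nat.modEq_zero_iff_dvd] at h6
    exact (Nat.dvd_add_left hkV).1 h6
  obtain ⟨δ, hδ0, hδ⟩ : ∃ δ : ℝ, 0 < δ ∧ ∀ q < V, δ ≤ weight k Q (τ q) := by
    obtain ⟨q, -, hq⟩ := Finset.exists_min_image (Finset.range V) (fun q => weight k Q (τ q))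
      ⟨0, Finset.mem_range.2 hV⟩
    exact ⟨_, hτw q, fun q' hq' => hq q' (Finset.mem_range.2 hq')⟩
  let N' := ∑ a, ∑ b, N a b
  refine ⟨s + 1 + V + V + N' + (1 + k * V), μ0 r * (w * (δ * (1 - 1 / (k : ℝ)) ^ V)),
    by positivity, fun n hn hnk => ?_⟩
  obtain ⟨d, hd⟩ : ∃ d, n = s + 1 + V + d := ⟨n - (s + 1 + V), by omega⟩
  have hkd : k ∣ d := by
    have h1 : s + V + d ≡ 0 [MOD k] := by
      refine Nat.ModEq.add_right_cancel' 1 ?_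
      convert hnk using 1
      omega
    rw [Nat.modEq_zero_iff_dvd] at h1
    exact (Nat.dvd_add_right (dvd_add hs hkV)).1 h1
  have hkr : k ∣ d % V := (Nat.dvd_mod_iff hkV).2 hkd
  obtain ⟨q, hq⟩ := hkr
  have hdV := Nat.div_add_mod d V
  have hrV := Nat.mod_lt d hV
  have hqV : q < V := by nlinarith
  obtain ⟨F, hFc, hF⟩ := exists_forests hk Q hM hle (d / V) x hx
  have hroots : ∀ f ∈ F, (τ q :: f).map PTree.root = r :: x := fun f h => by
    simp [hτr, (hF f h).1]
  refine ⟨d / V, F.image fun f => C (τ q :: f), ?_, ?_, ?_, ?_⟩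
  · rw [mul_comm]; omega
  · rw [mul_comm]; omega
  · rw [Finset.card_image_of_injOn, hFc]
    intro f h f' h' heq
    exact (List.cons.inj (hC (hroots f h) (hroots f' h') heq)).2
  · intro t ht
    obtain ⟨f, h, rfl⟩ := Finset.mem_image.1 ht
    obtain ⟨h1, h2, h3, h4⟩ := hf _ (hroots f h)
    obtain ⟨-, g2, g3, g4⟩ := hF f h
    refine ⟨?_, fun a b => ?_, ?_⟩
    · rw [h3, List.map_cons, List.sum_cons, hτs, g3, hxV]
      have : (d / V + 1) * V = V * (d / V) + V := by ring
      omega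
    · rw [h2, List.map_cons, List.sum_cons, g2]
      have h5 := pairCount_le_size (τ q) a b
      rw [hτs] at h5
      have h6 : k * q ≤ k * V := Nat.mul_le_mul_left _ hqV.le
      have h7 : N a b ≤ N' := (Finset.single_le_sum (f := fun b => N a b)
        (fun _ _ => Nat.zero_le _) (Finset.mem_univ b)).trans
        (Finset.single_le_sum (f := fun a => ∑ b, N a b) (fun _ _ => Nat.zero_le _)
          (Finset.mem_univ a))
      omega
    · rw [jointWeight_eq, h1, h4, List.map_cons, List.prod_cons, g4, hxV]
      have := mul_le_mul_of_nonneg_right (hδ q hqV)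
        (by positivity : 0 ≤ μ0 r * w * ((1 - 1 / (k : ℝ)) ^ V * rowWeight k Q J M ^ (d / V)))
      linarith

/-- The first marginal of a matrix. -/
noncomputable def fstMarg (μ : 𝒳 × 𝒳 → ℝ) (a : 𝒳) : ℝ := ∑ b, μ (a, b)

/-- The second marginal of a matrix. -/
noncomputable def sndMarg (μ : 𝒳 × 𝒳 → ℝ) (b : 𝒳) : ℝ := ∑ a, μ (a, b)

/-- The finite part of the rate function, written through the continuous function `x log x`. -/
noncomputable def rate (k : ℕ) (Q : 𝒳 → 𝒳 → ℝ) (μ : 𝒳 × 𝒳 → ℝ) : ℝ :=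
  ∑ a, ∑ b, (μ (a, b) * Real.log (μ (a, b)) - μ (a, b) * Real.log (Q a b)) +
    ∑ a, (fstMarg μ a / k * Real.log (fstMarg μ a / k) +
      (sndMarg μ a - fstMarg μ a / k) * Real.log (sndMarg μ a - fstMarg μ a / k) -
      fstMarg μ a * Real.log (fstMarg μ a) - sndMarg μ a * Real.log (sndMarg μ a) +
      fstMarg μ a / k * Real.log k -
      (sndMarg μ a - fstMarg μ a / k) * Real.log (1 - 1 / (k : ℝ)))

/-- The set on which the rate function is finite. -/
def Feasible (k : ℕ) (Q : 𝒳 → 𝒳 → ℝ) (μ : 𝒳 × 𝒳 → ℝ) : Prop :=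
  (∀ a, fstMarg μ a ≤ k * sndMarg μ a) ∧ ∀ a b, Q a b = 0 → μ (a, b) = 0

@[fun_prop]
theorem continuous_fstMarg (a : 𝒳) : Continuous fun μ : 𝒳 × 𝒳 → ℝ => fstMarg μ a := by
  unfold fstMarg; fun_prop

@[fun_prop]
theorem continuous_sndMarg (a : 𝒳) : Continuous fun μ : 𝒳 × 𝒳 → ℝ => sndMarg μ a := by
  unfold sndMarg; fun_prop

theorem continuous_rate (k : ℕ) (Q : 𝒳 → 𝒳 → ℝ) : Continuous (rate k Q) := by
  have h : ∀ f : (𝒳 × 𝒳 → ℝ) → ℝ, Continuous f → Continuous fun μ => f μ * Real.log (f μ) :=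
    fun f hf => Real.continuous_mul_log.comp hf
  unfold rate
  refine Continuous.add (continuous_finsetSum _ fun a _ => continuous_finsetSum _ fun b _ => ?_)
    (continuous_finsetSum _ fun a _ => ?_)
  · exact (h _ (by fun_prop)).sub (by fun_prop)
  · exact (((((h _ (by fun_prop)).add (h _ (by fun_prop))).sub (h _ (by fun_prop))).sub
      (h _ (by fun_prop))).add (by fun_prop)).sub (by fun_prop)

theorem isClosed_feasible (k : ℕ) (Q : 𝒳 → 𝒳 → ℝ) : IsClosed {μ | Feasible k Q μ} := by
  unfold Feasible
  simp only [Set.ofPred_and, Set.ofPred_forall]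
  refine IsClosed.inter (isClosed_iInter fun a => isClosed_le (by fun_prop) (by fun_prop))
    (isClosed_iInter fun a => isClosed_iInter fun b => isClosed_iInter fun _ =>
      isClosed_eq (by fun_prop) (by fun_prop))

theorem isCompact_probVec : IsCompact {μ : 𝒳 × 𝒳 → ℝ | IsProbVec μ} := by
  refine (isCompact_univ_pi fun _ : 𝒳 × 𝒳 => isCompact_Icc (a := (0 : ℝ)) (b := 1)).of_isClosed_subset
    ?_ ?_
  · unfold IsProbVec
    simp only [Set.ofPred_and, Set.ofPred_forall]
    exact IsClosed.inter (isClosed_iInter fun a => isClosed_le (by fun_prop) (by fun_prop))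
      (isClosed_eq (by fun_prop) (by fun_prop))
  · intro μ hμ x _
    exact ⟨hμ.1 x, hμ.2 ▸ Finset.single_le_sum (fun y _ => hμ.1 y) (Finset.mem_univ x)⟩

theorem fstMarg_nonneg {μ : 𝒳 × 𝒳 → ℝ} (hμ : ∀ x, 0 ≤ μ x) (a : 𝒳) : 0 ≤ fstMarg μ a :=
  Finset.sum_nonneg fun _ _ => hμ _

theorem sndMarg_nonneg {μ : 𝒳 × 𝒳 → ℝ} (hμ : ∀ x, 0 ≤ μ x) (a : 𝒳) : 0 ≤ sndMarg μ a :=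
  Finset.sum_nonneg fun _ _ => hμ _

theorem le_fstMarg {μ : 𝒳 × 𝒳 → ℝ} (hμ : ∀ x, 0 ≤ μ x) (a b : 𝒳) : μ (a, b) ≤ fstMarg μ a :=
  Finset.single_le_sum (f := fun b => μ (a, b)) (fun _ _ => hμ _) (Finset.mem_univ b)

theorem sum_fstMarg {μ : 𝒳 × 𝒳 → ℝ} (hμ : IsProbVec μ) : ∑ a, fstMarg μ a = 1 := by
  rw [← hμ.2, Fintype.sum_prod_type]; rfl

theorem sum_sndMarg {μ : 𝒳 × 𝒳 → ℝ} (hμ : IsProbVec μ) : ∑ a, sndMarg μ a = 1 := by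
  rw [← hμ.2, Fintype.sum_prod_type_right]; rfl

theorem relEnt_eq {α : Type*} [Fintype α] {ν ρ : α → ℝ} (hν : ∀ a, 0 ≤ ν a) (hρ : ∀ a, 0 ≤ ρ a)
    (h : ∀ a, ρ a = 0 → ν a = 0) (hs : ∑ a, ν a = ∑ a, ρ a) :
    (relEnt ν ρ : EReal) = ((∑ a, ν a * Real.log (ν a / ρ a) : ℝ) : EReal) := by
  have key : ∀ a, 0 ≤ ν a * Real.log (ν a / ρ a) + ρ a - ν a := by
    intro a
    rcases (hν a).eq_or_lt with h0 | h0
    · simp [← h0, hρ a]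
    · have hρ0 : 0 < ρ a := (hρ a).lt_of_ne fun h' => h0.ne' (h a h'.symm)
      have := Real.one_sub_inv_le_log_of_pos (div_pos h0 hρ0)
      have h2 : ν a * (1 - (ν a / ρ a)⁻¹) = ν a - ρ a := by field_simp
      nlinarith
  rw [relEnt, if_pos h, tsum_fintype, ← ENNReal.ofReal_sum_of_nonneg fun a _ => key a,
    EReal.coe_ennreal_ofReal, max_eq_left (Finset.sum_nonneg fun a _ => key a)]
  congr 1
  rw [Finset.sum_sub_distrib, Finset.sum_add_distrib, hs]
  ring

theorem rateKary_of_feasible {k : ℕ} (hk : 2 ≤ k) {Q : 𝒳 → 𝒳 → ℝ} (hQ : ∀ a b, 0 ≤ Q a b)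
    (hQ_sum : ∀ a, ∑ b, Q a b = 1) {μ : 𝒳 × 𝒳 → ℝ} (hμ : IsProbVec μ) (h : Feasible k Q μ) :
    rateKary k Q μ = (rate k Q μ : EReal) := by
  have hk2 : (2 : ℝ) ≤ k := by exact_mod_cast hk
  have hk1 : (0 : ℝ) < k - 1 := by linarith
  have hk0 : (0 : ℝ) < k := by linarith
  have h1 := fstMarg_nonneg hμ.1
  have h2 := sndMarg_nonneg hμ.1
  have hac : ∀ a, sndMarg μ a = 0 → fstMarg μ a = 0 := fun a ha =>
    le_antisymm (by simpa [ha] using h.1 a) (h1 a)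
  have e1 : (relEnt μ (fun x => fstMarg μ x.1 * Q x.1 x.2) : EReal) = _ :=
    relEnt_eq hμ.1 (fun x => mul_nonneg (h1 _) (hQ _ _)) (fun x hx => by
      rcases mul_eq_zero.1 hx with h' | h'
      · exact le_antisymm (h' ▸ le_fstMarg hμ.1 x.1 x.2) (hμ.1 x)
      · exact h.2 _ _ h') (by
      rw [hμ.2, Fintype.sum_prod_type]
      simp [← Finset.mul_sum, hQ_sum, sum_fstMarg hμ])
  have e2 : (relEnt (fun a => (k * sndMarg μ a - fstMarg μ a) / ((k : ℝ) - 1)) (sndMarg μ) :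
      EReal) = _ :=
    relEnt_eq (fun a => div_nonneg (by linarith [h.1 a]) hk1.le) h2
      (fun a ha => by simp [ha, hac a ha]) (by
      rw [← Finset.sum_div, Finset.sum_sub_distrib, ← Finset.mul_sum, sum_fstMarg hμ, sum_sndMarg hμ]
      field_simp)
  have e3 : (relEnt (fstMarg μ) (sndMarg μ) : EReal) = _ :=
    relEnt_eq h1 h2 hac (by rw [sum_fstMarg hμ, sum_sndMarg hμ])
  have hd : rateKary k Q μ = (relEnt μ (fun x => fstMarg μ x.1 * Q x.1 x.2) : EReal)
      + ((((k : ℝ) - 1) / k : ℝ) : EReal) *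
          (relEnt (fun a => (k * sndMarg μ a - fstMarg μ a) / ((k : ℝ) - 1)) (sndMarg μ) : EReal)
      + ((1 / (k : ℝ) : ℝ) : EReal) * (relEnt (fstMarg μ) (sndMarg μ) : EReal) := if_pos h.1
  rw [hd, e1, e2, e3, ← EReal.coe_mul, ← EReal.coe_mul, ← EReal.coe_add, ← EReal.coe_add]
  congr 1
  rw [Fintype.sum_prod_type, rate, Finset.mul_sum, Finset.mul_sum, ← Finset.sum_add_distrib,
    ← Finset.sum_add_distrib, ← Finset.sum_add_distrib]
  refine Finset.sum_congr rfl fun a _ => ?_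
  have r1 : ∑ b, μ (a, b) * Real.log (μ (a, b) / (fstMarg μ a * Q a b)) =
      ∑ b, (μ (a, b) * Real.log (μ (a, b)) - μ (a, b) * Real.log (Q a b)) -
        fstMarg μ a * Real.log (fstMarg μ a) := by
    unfold fstMarg
    rw [Finset.sum_mul, ← Finset.sum_sub_distrib]
    refine Finset.sum_congr rfl fun b _ => ?_
    rcases (hμ.1 (a, b)).eq_or_lt with h0 | h0
    · simp [← h0]
    · have hf : ∑ b, μ (a, b) ≠ 0 := (h0.trans_le (le_fstMarg hμ.1 a b)).ne'
      have hq : Q a b ≠ 0 := fun h' => h0.ne' (h.2 a b h')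
      rw [Real.log_div h0.ne' (mul_ne_zero hf hq), Real.log_mul hf hq]
      ring
  have r2 : (k - 1 : ℝ) / k * ((k * sndMarg μ a - fstMarg μ a) / ((k : ℝ) - 1) *
      Real.log ((k * sndMarg μ a - fstMarg μ a) / ((k : ℝ) - 1) / sndMarg μ a)) =
      (sndMarg μ a - fstMarg μ a / k) * Real.log (sndMarg μ a - fstMarg μ a / k) -
      (sndMarg μ a - fstMarg μ a / k) * Real.log (sndMarg μ a) -
      (sndMarg μ a - fstMarg μ a / k) * Real.log (1 - 1 / (k : ℝ)) := by
    rcases eq_or_ne (sndMarg μ a - fstMarg μ a / k) 0 with h0 | h0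
    · have : k * sndMarg μ a - fstMarg μ a = 0 := by field_simp at h0; linarith
      simp [h0, this]
    · have hs : sndMarg μ a ≠ 0 := fun h' => h0 (by simp [h', hac a h'])
      have hkk : 1 - 1 / (k : ℝ) ≠ 0 := (karyLaw_zero_pos hk).ne'
      have hk1' := hk1.ne'
      have : (k * sndMarg μ a - fstMarg μ a) / ((k : ℝ) - 1) / sndMarg μ a =
          (sndMarg μ a - fstMarg μ a / k) / (1 - 1 / (k : ℝ)) / sndMarg μ a := by
        field_simp
      rw [this, Real.log_div (div_ne_zero h0 hkk) hs, Real.log_div h0 hkk]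
      field_simp
      ring
  have r3 : 1 / (k : ℝ) * (fstMarg μ a * Real.log (fstMarg μ a / sndMarg μ a)) =
      fstMarg μ a / k * Real.log (fstMarg μ a / k) + fstMarg μ a / k * Real.log k -
        fstMarg μ a / k * Real.log (sndMarg μ a) := by
    rcases eq_or_ne (fstMarg μ a) 0 with h0 | h0
    · simp [h0]
    · have hs : sndMarg μ a ≠ 0 := fun h' => h0 (hac a h')
      rw [Real.log_div h0 hs, Real.log_div h0 hk0.ne']
      ring
  rw [r1, r2, r3]
  ring

theorem rateKary_of_not_feasible {k : ℕ} (hk : 2 ≤ k) {Q : 𝒳 → 𝒳 → ℝ}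
    {μ : 𝒳 × 𝒳 → ℝ} (h : ¬ Feasible k Q μ) :
    rateKary k Q μ = ⊤ := by
  have hk2 : (2 : ℝ) ≤ k := by exact_mod_cast hk
  rw [rateKary]
  split_ifs with h1
  · have h2 : ¬ ∀ x : 𝒳 × 𝒳, fstMarg μ x.1 * Q x.1 x.2 = 0 → μ x = 0 := fun h' =>
      h ⟨h1, fun a b hab => h' (a, b) (by simp [hab])⟩
    have : relEnt μ (fun x => (∑ b, μ (x.1, b)) * Q x.1 x.2) = ∞ := by
      rw [relEnt]; exact if_neg h2
    rw [this, EReal.coe_ennreal_top, EReal.top_add_of_ne_bot, EReal.top_add_of_ne_bot]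
    · exact ne_bot_of_le_ne_bot EReal.zero_ne_bot
        (mul_nonneg (EReal.coe_nonneg.2 (by positivity)) (EReal.coe_ennreal_nonneg _))
    · exact ne_bot_of_le_ne_bot EReal.zero_ne_bot
        (mul_nonneg (EReal.coe_nonneg.2 (div_nonneg (by linarith) (by linarith)))
          (EReal.coe_ennreal_nonneg _))
  · rfl

theorem lowerSemicontinuous_rateKary {k : ℕ} (hk : 2 ≤ k) {Q : 𝒳 → 𝒳 → ℝ}
    (hQ : ∀ a b, 0 ≤ Q a b) (hQ_sum : ∀ a, ∑ b, Q a b = 1) :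
    LowerSemicontinuous fun μ : PV 𝒳 => rateKary k Q μ.1 := by
  rw [lowerSemicontinuous_iff_isClosed_preimage]
  intro y
  rcases eq_or_ne y ⊤ with rfl | hy
  · simp
  · have : (fun μ : PV 𝒳 => rateKary k Q μ.1) ⁻¹' Set.Iic y =
        {μ : PV 𝒳 | Feasible k Q μ.1} ∩ {μ : PV 𝒳 | (rate k Q μ.1 : EReal) ≤ y} := by
      ext μ
      by_cases h : Feasible k Q μ.1
      · simp [h, rateKary_of_feasible hk hQ hQ_sum μ.2 h]
      · simp [h, rateKary_of_not_feasible hk h, hy]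
    rw [this]
    exact ((isClosed_feasible k Q).preimage continuous_subtype_val).inter
      (isClosed_le (continuous_coe_real_ereal.comp
        ((continuous_rate k Q).comp continuous_subtype_val)) continuous_const)

instance compactSpace_probVec : CompactSpace (PV 𝒳) :=
  isCompact_iff_compactSpace.1 isCompact_probVec

theorem log_factorial_le (n : ℕ) :
    Real.log (n.factorial : ℝ) ≤ n * Real.log n - n + 1 + Real.log (n + 1) := by
  suffices h : Real.log (n.factorial : ℝ) ≤ n * Real.log n - n + 1 + Real.log n by
    have h4 : Real.log (n : ℝ) ≤ Real.log (n + 1) := by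
      rcases Nat.eq_zero_or_pos n with rfl | hn
      · simp
      · exact Real.log_le_log (by exact_mod_cast hn) (by linarith)
    linarith
  induction n with
  | zero => simp
  | succ n ih =>
    rw [Nat.factorial_succ, Nat.cast_mul, Real.log_mul (by positivity) (by positivity)]
    push_cast
    rcases Nat.eq_zero_or_pos n with rfl | hn
    · norm_num
    have h1 : (0 : ℝ) < n := by exact_mod_cast hn
    have h2 := Real.one_sub_inv_le_log_of_pos (show (0 : ℝ) < (n + 1) / n by positivity)
    rw [Real.log_div (by positivity) h1.ne'] at h2
    have h3 : (1 : ℝ) - (((n : ℝ) + 1) / n)⁻¹ = 1 / ((n : ℝ) + 1) := by field_simp; ring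
    rw [h3, div_le_iff₀ (by positivity)] at h2
    nlinarith

theorem le_log_factorial (n : ℕ) : n * Real.log n - n ≤ Real.log (n.factorial : ℝ) := by
  induction n with
  | zero => simp
  | succ n ih =>
    rw [Nat.factorial_succ, Nat.cast_mul, Real.log_mul (by positivity) (by positivity)]
    push_cast
    rcases Nat.eq_zero_or_pos n with rfl | hn
    · norm_num
    have h1 : (0 : ℝ) < n := by exact_mod_cast hn
    have h2 := Real.log_le_sub_one_of_pos (show (0 : ℝ) < (n + 1) / n by positivity)
    rw [Real.log_div (by positivity) h1.ne'] at h2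
    have h3 : ((n : ℝ) + 1) / n - 1 = 1 / n := by field_simp; ring
    rw [h3, le_div_iff₀ (by positivity)] at h2
    nlinarith

theorem tendsto_log_add_one_div {n : ℕ → ℕ} {ν : ℝ}
    (hn : Tendsto (fun L : ℕ => (n L : ℝ) / L) atTop (nhds ν)) :
    Tendsto (fun L : ℕ => (1 + Real.log (n L + 1)) / L) atTop (nhds 0) := by
  have hL : Tendsto (fun L : ℕ => (L : ℝ)) atTop atTop := tendsto_natCast_atTop_atTop
  have hlog : Tendsto (fun L : ℕ => Real.log L / L) atTop (nhds 0) :=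
    (Real.isLittleO_log_id_atTop.tendsto_div_nhds_zero).comp hL
  have hinv : Tendsto (fun L : ℕ => ((L : ℝ))⁻¹) atTop (nhds 0) := tendsto_inv_atTop_zero.comp hL
  have hup : Tendsto (fun L : ℕ => (L : ℝ)⁻¹ * (1 + Real.log (ν + 2)) + Real.log L / L) atTop
      (nhds 0) := by simpa using (hinv.mul_const (1 + Real.log (ν + 2))).add hlog
  refine tendsto_of_tendsto_of_tendsto_of_le_of_le' tendsto_const_nhds hup
    (Eventually.of_forall fun L => ?_) ?_
  · exact div_nonneg (add_nonneg zero_le_one (Real.log_nonneg (by simp))) (Nat.cast_nonneg _)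
  · have hν : 0 ≤ ν := ge_of_tendsto' hn fun L => by positivity
    filter_upwards [eventually_ge_atTop 1, hn.eventually (gt_mem_nhds (lt_add_one ν))] with L h1 h2
    have h1' : (1 : ℝ) ≤ L := by exact_mod_cast h1
    rw [div_lt_iff₀ (by linarith)] at h2
    have h3 : Real.log ((n L : ℝ) + 1) ≤ Real.log (ν + 2) + Real.log L := by
      rw [← Real.log_mul (by linarith) (by linarith)]
      exact Real.log_le_log (by positivity) (by nlinarith)
    have hL0 : (L : ℝ) ≠ 0 := by linarith
    rw [div_eq_inv_mul, div_eq_inv_mul, ← mul_add]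
    exact mul_le_mul_of_nonneg_left (by linarith) (by positivity)

theorem tendsto_log_factorial_div {n : ℕ → ℕ} {ν : ℝ}
    (hn : Tendsto (fun L : ℕ => (n L : ℝ) / L) atTop (nhds ν)) :
    Tendsto (fun L : ℕ => (Real.log ((n L).factorial : ℝ) - n L * Real.log L + n L) / L) atTop
      (nhds (ν * Real.log ν)) := by
  have h1 : Tendsto (fun L : ℕ => (n L : ℝ) / L * Real.log ((n L : ℝ) / L)) atTop
      (nhds (ν * Real.log ν)) := (Real.continuous_mul_log.tendsto ν).comp hn
  have h2 := h1.add (tendsto_log_add_one_div hn)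
  rw [add_zero] at h2
  have key : ∀ L : ℕ, 1 ≤ L → (n L : ℝ) / L * Real.log ((n L : ℝ) / L) =
      (n L * Real.log (n L) - n L * Real.log L) / L := by
    intro L hL
    have hL0 : (L : ℝ) ≠ 0 := by positivity
    rcases eq_or_ne (n L : ℝ) 0 with h0 | h0
    · simp [h0]
    · rw [Real.log_div h0 hL0]; ring
  refine tendsto_of_tendsto_of_tendsto_of_le_of_le' h1 h2 ?_ ?_
  · filter_upwards [eventually_ge_atTop 1] with L hL
    rw [key L hL]
    exact div_le_div_of_nonneg_right (by linarith [le_log_factorial (n L)]) (Nat.cast_nonneg _)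
  · filter_upwards [eventually_ge_atTop 1] with L hL
    rw [key L hL, ← add_div]
    exact div_le_div_of_nonneg_right (by linarith [log_factorial_le (n L)]) (Nat.cast_nonneg _)

theorem rowWeight_pos {k : ℕ} (hk : 2 ≤ k) {Q : 𝒳 → 𝒳 → ℝ} (hQ : ∀ a b, 0 ≤ Q a b)
    {J : 𝒳 → 𝒳 → ℕ} (hJQ : ∀ a b, Q a b = 0 → J a b = 0) (M : 𝒳 → ℕ) :
    0 < rowWeight k Q J M := by
  have h := karyLaw_zero_pos hk
  refine mul_pos (Finset.prod_pos fun a _ => by positivity)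
    (Finset.prod_pos fun a _ => Finset.prod_pos fun b _ => ?_)
  rcases (hQ a b).eq_or_lt with h0 | h0
  · simp [hJQ a b h0.symm]
  · positivity

theorem rowCount_pos (J : 𝒳 → 𝒳 → ℕ) (M : 𝒳 → ℕ) : 0 < rowCount J M := by
  unfold rowCount
  positivity

theorem log_rowCount (J : 𝒳 → 𝒳 → ℕ) (M : 𝒳 → ℕ) (hle : ∀ a, M a ≤ ∑ b, J b a)
    (f : ℕ → ℝ) (c : ℝ) (hf : ∀ n : ℕ, Real.log (n.factorial : ℝ) = f n + n * c) :
    Real.log (rowCount J M) =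
      ∑ a, (f (∑ b, J b a) - f (M a) - f (∑ b, J b a - M a)) +
        ∑ a, (f (∑ b, J a b) - ∑ b, f (J a b)) := by
  have hpos : ∀ n : ℕ, (n.factorial : ℝ) ≠ 0 := fun n => by positivity
  rw [rowCount, Real.log_mul (by positivity) (by positivity),
    Real.log_prod fun a _ => by positivity, Real.log_prod fun a _ => by positivity]
  congr 1 <;> refine Finset.sum_congr rfl fun a _ => ?_
  · rw [Real.log_div (hpos _) (mul_ne_zero (hpos _) (hpos _)), Real.log_mul (hpos _) (hpos _),
      hf, hf, hf, Nat.cast_sub (hle a)]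
    ring
  · rw [Real.log_div (hpos _) (by positivity), Real.log_prod fun b _ => hpos _, hf]
    simp only [hf, Finset.sum_add_distrib, Nat.cast_sum, Finset.sum_mul]
    ring

theorem log_rowWeight {k : ℕ} (hk : 2 ≤ k) {Q : 𝒳 → 𝒳 → ℝ}
    {J : 𝒳 → 𝒳 → ℕ} (hJQ : ∀ a b, Q a b = 0 → J a b = 0) (M : 𝒳 → ℕ) :
    Real.log (rowWeight k Q J M) =
      ∑ a, (-(M a * Real.log k) + (∑ b, J b a - M a : ℕ) * Real.log (1 - 1 / (k : ℝ))) +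
        ∑ a, ∑ b, J a b * Real.log (Q a b) := by
  have h := karyLaw_zero_pos hk
  have hne : ∀ a b, Q a b ^ J a b ≠ 0 := fun a b => by
    rcases eq_or_ne (Q a b) 0 with h0 | h0
    · simp [hJQ a b h0]
    · exact pow_ne_zero _ h0
  rw [rowWeight, Real.log_mul (Finset.prod_ne_zero_iff.2 fun a _ => by positivity)
    (Finset.prod_ne_zero_iff.2 fun a _ => Finset.prod_ne_zero_iff.2 fun b _ => hne a b),
    Real.log_prod fun a _ => by positivity,
    Real.log_prod fun a _ => Finset.prod_ne_zero_iff.2 fun b _ => hne a b]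
  congr 1 <;> refine Finset.sum_congr rfl fun a _ => ?_
  · rw [Real.log_mul (by positivity) (by positivity), Real.log_pow, Real.log_pow, one_div,
      Real.log_inv]
    ring
  · rw [Real.log_prod fun b _ => hne a b]
    simp only [Real.log_pow]

theorem tendsto_log_row {k : ℕ} (hk : 2 ≤ k) {Q : 𝒳 → 𝒳 → ℝ} (hQ : ∀ a b, 0 ≤ Q a b)
    {μ : 𝒳 × 𝒳 → ℝ} {J : ℕ → 𝒳 → 𝒳 → ℕ} {M : ℕ → 𝒳 → ℕ}
    (hJ : ∀ a b, Tendsto (fun L : ℕ => (J L a b : ℝ) / L) atTop (nhds (μ (a, b))))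
    (hM : ∀ L a, ∑ b, J L a b = k * M L a)
    (hle : ∀ᶠ L in atTop, ∀ a, M L a ≤ ∑ b, J L b a)
    (hJQ : ∀ L a b, Q a b = 0 → J L a b = 0) :
    Tendsto (fun L : ℕ => Real.log (rowCount (J L) (M L) * rowWeight k Q (J L) (M L)) / L) atTop
      (nhds (-rate k Q μ)) := by
  have hk0 : (k : ℝ) ≠ 0 := by positivity
  have h1 : ∀ a, Tendsto (fun L : ℕ => ((∑ b, J L a b : ℕ) : ℝ) / L) atTop (nhds (fstMarg μ a)) := by
    intro a
    simp only [Nat.cast_sum, Finset.sum_div]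
    exact tendsto_finsetSum _ fun b _ => hJ a b
  have h2 : ∀ a, Tendsto (fun L : ℕ => ((∑ b, J L b a : ℕ) : ℝ) / L) atTop (nhds (sndMarg μ a)) := by
    intro a
    simp only [Nat.cast_sum, Finset.sum_div]
    exact tendsto_finsetSum _ fun b _ => hJ b a
  have h3 : ∀ a, Tendsto (fun L : ℕ => (M L a : ℝ) / L) atTop (nhds (fstMarg μ a / k)) := by
    intro a
    refine ((h1 a).div_const (k : ℝ)).congr fun L => ?_
    rw [hM, Nat.cast_mul]
    field_simp
  have h4 : ∀ a, Tendsto (fun L : ℕ => ((∑ b, J L b a - M L a : ℕ) : ℝ) / L) atTop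
      (nhds (sndMarg μ a - fstMarg μ a / k)) := by
    intro a
    refine ((h2 a).sub (h3 a)).congr' ?_
    filter_upwards [hle] with L hL
    rw [Nat.cast_sub (hL a), sub_div]
  let f : ℕ → ℕ → ℝ := fun L n => Real.log (n.factorial : ℝ) - n * Real.log L + n
  have hf : ∀ {n : ℕ → ℕ} {ν : ℝ}, Tendsto (fun L : ℕ => (n L : ℝ) / L) atTop (nhds ν) →
      Tendsto (fun L : ℕ => f L (n L) / L) atTop (nhds (ν * Real.log ν)) :=
    fun h => tendsto_log_factorial_div h
  have hlim : Tendsto (fun L : ℕ =>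
      ∑ a, (f L (∑ b, J L b a) / L - f L (M L a) / L - f L (∑ b, J L b a - M L a) / L) +
        ∑ a, (f L (∑ b, J L a b) / L - ∑ b, f L (J L a b) / L) +
      (∑ a, (-(M L a / L * Real.log k) +
        (∑ b, J L b a - M L a : ℕ) / L * Real.log (1 - 1 / (k : ℝ))) +
        ∑ a, ∑ b, J L a b / L * Real.log (Q a b))) atTop (nhds _) :=
    ((tendsto_finsetSum _ fun a _ => ((hf (h2 a)).sub (hf (h3 a))).sub (hf (h4 a))).add
      (tendsto_finsetSum _ fun a _ => (hf (h1 a)).sub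
        (tendsto_finsetSum _ fun b _ => hf (hJ a b)))).add
      ((tendsto_finsetSum _ fun a _ => ((h3 a).mul_const _).neg.add ((h4 a).mul_const _)).add
        (tendsto_finsetSum _ fun a _ => tendsto_finsetSum _ fun b _ => (hJ a b).mul_const _))
  refine (hlim.congr' ?_).trans (le_of_eq ?_)
  · filter_upwards [hle] with L hL
    rw [Real.log_mul (rowCount_pos _ _).ne' (rowWeight_pos hk hQ (hJQ L) _).ne',
      log_rowCount (J L) (M L) hL (f L) (Real.log L - 1) (fun n => by simp only [f]; ring),
      log_rowWeight hk (hJQ L)]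
    simp only [add_div, sub_div, Finset.sum_div, neg_div, mul_div_right_comm]
  · congr 1
    simp only [rate, ← Finset.sum_add_distrib, ← Finset.sum_neg_distrib]
    refine Finset.sum_congr rfl fun a _ => ?_
    rw [Finset.sum_sub_distrib]
    ring

theorem exists_stationary [Nonempty 𝒳] {Q : 𝒳 → 𝒳 → ℝ} (hQ : ∀ a b, 0 ≤ Q a b)
    (hQ_sum : ∀ a, ∑ b, Q a b = 1)
    (hQ_irr : ∀ a b, ∃ m : ℕ, 0 < ((Matrix.of Q) ^ (m + 1)) a b) :
    ∃ p : 𝒳 → ℝ, (∀ a, 0 < p a) ∧ ∑ a, p a = 1 ∧ ∀ b, ∑ a, p a * Q a b = p b := by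
  have hdet : (Matrix.of Q - 1).det = 0 := by
    refine Matrix.exists_mulVec_eq_zero_iff.1 ⟨fun _ => 1, ?_, ?_⟩
    · exact fun h => one_ne_zero (congrFun h (Classical.arbitrary 𝒳))
    · ext a
      rw [Matrix.sub_mulVec, Matrix.one_mulVec]
      simp [Matrix.mulVec, dotProduct, hQ_sum]
  obtain ⟨w, hw0, hw⟩ := Matrix.exists_vecMul_eq_zero_iff.2 hdet
  have hw' : ∀ b, ∑ a, w a * Q a b = w b := fun b => by
    have := congrFun hw b
    rw [Matrix.vecMul_sub, Matrix.vecMul_one, Pi.sub_apply, Pi.zero_apply, sub_eq_zero] at this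
    exact this
  have hle : ∀ b ∈ Finset.univ, |w b| ≤ ∑ a, |w a| * Q a b := fun b _ => by
    rw [← hw' b]
    refine (Finset.abs_sum_le_sum_abs _ _).trans_eq (Finset.sum_congr rfl fun a _ => ?_)
    rw [abs_mul, abs_of_nonneg (hQ a b)]
  have hsum : ∑ b, |w b| = ∑ b, ∑ a, |w a| * Q a b := by
    rw [Finset.sum_comm]
    simp [← Finset.mul_sum, hQ_sum]
  have heq : ∀ b, ∑ a, |w a| * Q a b = |w b| := fun b =>
    ((Finset.sum_eq_sum_iff_of_le hle).1 hsum b (Finset.mem_univ b)).symm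
  have hpow : ∀ m : ℕ, (∀ a b, 0 ≤ ((Matrix.of Q) ^ m) a b) ∧
      ∀ b, ∑ a, |w a| * ((Matrix.of Q) ^ m) a b = |w b| := by
    intro m
    induction m with
    | zero =>
      refine ⟨fun a b => ?_, fun b => ?_⟩
      · rw [pow_zero, Matrix.one_apply]; split_ifs <;> norm_num
      · simp [Matrix.one_apply]
    | succ m ih =>
      refine ⟨fun a b => ?_, fun b => ?_⟩
      · rw [pow_succ, Matrix.mul_apply]
        exact Finset.sum_nonneg fun c _ => mul_nonneg (ih.1 _ _) (hQ _ _)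
      · simp only [pow_succ, Matrix.mul_apply, Finset.mul_sum]
        rw [Finset.sum_comm]
        simp only [← mul_assoc, ← Finset.sum_mul, ih.2]
        exact heq b
  obtain ⟨a0, ha0⟩ : ∃ a, w a ≠ 0 := by
    by_contra! h
    exact hw0 (funext h)
  have hpos : ∀ b, 0 < |w b| := fun b => by
    obtain ⟨m, hm⟩ := hQ_irr a0 b
    rw [← (hpow (m + 1)).2 b]
    exact (mul_pos (abs_pos.2 ha0) hm).trans_le
      (Finset.single_le_sum (f := fun a => |w a| * ((Matrix.of Q) ^ (m + 1)) a b)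
        (fun a _ => mul_nonneg (abs_nonneg _) ((hpow (m + 1)).1 a b)) (Finset.mem_univ a0))
  have hS : 0 < ∑ a, |w a| := Finset.sum_pos (fun a _ => hpos a) Finset.univ_nonempty
  refine ⟨fun a => |w a| / ∑ a, |w a|, fun a => div_pos (hpos a) hS, ?_, fun b => ?_⟩
  · rw [← Finset.sum_div, div_self hS.ne']
  · simp only [div_mul_eq_mul_div, ← Finset.sum_div, heq]

/-- The stationary pair measure is a zero of the rate function. -/
theorem exists_isProbVec_rate_eq_zero [Nonempty 𝒳] {k : ℕ} (hk : 2 ≤ k) {Q : 𝒳 → 𝒳 → ℝ}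
    (hQ : ∀ a b, 0 ≤ Q a b) (hQ_sum : ∀ a, ∑ b, Q a b = 1)
    (hQ_irr : ∀ a b, ∃ m : ℕ, 0 < ((Matrix.of Q) ^ (m + 1)) a b) :
    ∃ ν : 𝒳 × 𝒳 → ℝ, IsProbVec ν ∧ rate k Q ν = 0 ∧ (∀ a b, 0 < Q a b → 0 < ν (a, b)) ∧
      (∀ a b, Q a b = 0 → ν (a, b) = 0) ∧ (∀ a, fstMarg ν a = sndMarg ν a) ∧
      ∀ a, 0 < fstMarg ν a := by
  obtain ⟨p, hp, hp1, hpQ⟩ := exists_stationary hQ hQ_sum hQ_irr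
  have hf : ∀ a, fstMarg (fun x => p x.1 * Q x.1 x.2) a = p a := fun a => by
    simp [fstMarg, ← Finset.mul_sum, hQ_sum]
  have hs : ∀ a, sndMarg (fun x => p x.1 * Q x.1 x.2) a = p a := fun a => by
    simp [sndMarg, hpQ]
  refine ⟨fun x => p x.1 * Q x.1 x.2, ⟨fun x => mul_nonneg (hp _).le (hQ _ _), ?_⟩, ?_,
    fun a b h => mul_pos (hp a) h, fun a b h => by simp [h], fun a => by rw [hf, hs],
    fun a => by rw [hf]; exact hp a⟩
  · rw [Fintype.sum_prod_type]
    simp [← Finset.mul_sum, hQ_sum, hp1]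
  · have hk0 : (k : ℝ) ≠ 0 := by positivity
    rw [rate, ← Finset.sum_add_distrib]
    refine Finset.sum_eq_zero fun a _ => ?_
    have h1 : ∑ b, (p a * Q a b * Real.log (p a * Q a b) - p a * Q a b * Real.log (Q a b)) =
        p a * Real.log (p a) := by
      rw [← mul_one (p a * Real.log (p a)), ← hQ_sum a, Finset.mul_sum]
      refine Finset.sum_congr rfl fun b _ => ?_
      rcases eq_or_ne (Q a b) 0 with h0 | h0
      · simp [h0]
      · rw [Real.log_mul (hp a).ne' h0]; ring
    have h2 : p a - p a / k = p a * (1 - 1 / (k : ℝ)) := by ring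
    rw [h1, hf, hs, h2, Real.log_mul (hp a).ne' (karyLaw_zero_pos hk).ne',
      Real.log_div (hp a).ne' hk0]
    ring

theorem exists_row {k : ℕ} (hk : 2 ≤ k) {Q : 𝒳 → 𝒳 → ℝ} (hQ : ∀ a b, 0 ≤ Q a b)
    {μ : 𝒳 × 𝒳 → ℝ} (hμ : IsProbVec μ) (hμQ : ∀ a b, Q a b = 0 → μ (a, b) = 0)
    (hμk : ∀ a, fstMarg μ a < k * sndMarg μ a) {U : Set (𝒳 × 𝒳 → ℝ)} (hU : U ∈ nhds μ) {r : ℝ}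
    (hr : r < -rate k Q μ) :
    ∃ (J : 𝒳 → 𝒳 → ℕ) (M : 𝒳 → ℕ), (∀ a, ∑ b, J a b = k * M a) ∧ (∀ a, M a ≤ ∑ b, J b a) ∧
      (∀ a b, Q a b = 0 → J a b = 0) ∧ 0 < ∑ a, ∑ b, J a b ∧
      (fun x => (J x.1 x.2 : ℝ) / (∑ a, ∑ b, J a b : ℕ)) ∈ U ∧
      r < Real.log (rowCount J M * rowWeight k Q J M) / (∑ a, ∑ b, J a b : ℕ) := by
  have hk0 : (0 : ℝ) < k := by positivity
  let m : ℕ → 𝒳 → 𝒳 → ℕ := fun L a b => ⌊μ (a, b) / k * L⌋₊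
  let J : ℕ → 𝒳 → 𝒳 → ℕ := fun L a b => k * m L a b
  let M : ℕ → 𝒳 → ℕ := fun L a => ∑ b, m L a b
  let V : ℕ → ℕ := fun L => ∑ a, ∑ b, J L a b
  have hm : ∀ a b, Tendsto (fun L : ℕ => (m L a b : ℝ) / L) atTop (nhds (μ (a, b) / k)) :=
    fun a b => (tendsto_nat_floor_mul_div_atTop (div_nonneg (hμ.1 _) hk0.le)).comp
      tendsto_natCast_atTop_atTop
  have hJ : ∀ a b, Tendsto (fun L : ℕ => (J L a b : ℝ) / L) atTop (nhds (μ (a, b))) := by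
    intro a b
    have := (hm a b).const_mul (k : ℝ)
    rw [mul_div_cancel₀ _ hk0.ne'] at this
    refine this.congr fun L => ?_
    simp only [J, Nat.cast_mul, mul_div_assoc]
  have hM : ∀ L a, ∑ b, J L a b = k * M L a := fun L a => by simp only [J, M, Finset.mul_sum]
  have hle : ∀ᶠ L in atTop, ∀ a, M L a ≤ ∑ b, J L b a := by
    refine eventually_all.2 fun a => ?_
    have h1 : Tendsto (fun L : ℕ => (M L a : ℝ) / L) atTop (nhds (fstMarg μ a / k)) := by
      simp only [M, fstMarg, Nat.cast_sum, Finset.sum_div]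
      exact tendsto_finsetSum _ fun b _ => hm a b
    have h2 : Tendsto (fun L : ℕ => ((∑ b, J L b a : ℕ) : ℝ) / L) atTop (nhds (sndMarg μ a)) := by
      simp only [sndMarg, Nat.cast_sum, Finset.sum_div]
      exact tendsto_finsetSum _ fun b _ => hJ b a
    have h3 : fstMarg μ a / k < sndMarg μ a := by
      rw [div_lt_iff₀' hk0]; exact hμk a
    filter_upwards [h1.eventually_lt h2 h3, eventually_gt_atTop 0] with L hL hL0
    have hL0' : (0 : ℝ) < L := by exact_mod_cast hL0
    exact_mod_cast ((div_lt_div_iff_of_pos_right hL0').1 hL).le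
  have hJQ : ∀ L a b, Q a b = 0 → J L a b = 0 := fun L a b h => by
    simp [J, m, hμQ a b h]
  have hV : Tendsto (fun L : ℕ => (V L : ℝ) / L) atTop (nhds 1) := by
    have h1 : ∑ a, ∑ b, μ (a, b) = 1 := by rw [← hμ.2, Fintype.sum_prod_type]
    rw [← h1]
    simp only [V, Nat.cast_sum, Finset.sum_div]
    exact tendsto_finsetSum _ fun a _ => tendsto_finsetSum _ fun b _ => hJ a b
  have hlog := tendsto_log_row hk hQ hJ hM hle hJQ
  have hlog' := hlog.div hV one_ne_zero
  rw [div_one] at hlog'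
  have hlim : Tendsto (fun (L : ℕ) (x : 𝒳 × 𝒳) => ((J L x.1 x.2 : ℝ) / L) / (V L / L)) atTop
      (nhds μ) := by
    refine tendsto_pi_nhds.2 fun x => ?_
    have := (hJ x.1 x.2).div hV one_ne_zero
    rwa [div_one] at this
  obtain ⟨L, h1, h2, h3, h4, h5⟩ := (hle.and <| (hlog'.eventually (lt_mem_nhds hr)).and <|
    (hlim.eventually hU).and <| (hV.eventually (lt_mem_nhds one_pos)).and
      (eventually_gt_atTop 0)).exists
  have hL0 : (L : ℝ) ≠ 0 := by positivity
  simp only [div_div_div_cancel_right₀ hL0, Pi.div_apply] at h2 h3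
  refine ⟨J L, M L, hM L, h1, hJQ L, ?_, h3, h2⟩
  rcases Nat.eq_zero_or_pos (V L) with h0 | h0
  · simp [h0] at h4
  · exact h0

theorem exp_le_mass_of_strict {k : ℕ} (hk : 2 ≤ k) {μ0 : 𝒳 → ℝ} (hμ0 : ∀ a, 0 ≤ μ0 a)
    (hμ0_sum : ∑ a, μ0 a = 1) {Q : 𝒳 → 𝒳 → ℝ} (hQ : ∀ a b, 0 ≤ Q a b)
    (hQ_sum : ∀ a, ∑ b, Q a b = 1)
    (hQ_irr : ∀ a b, ∃ m : ℕ, 0 < ((Matrix.of Q) ^ (m + 1)) a b)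
    {μ : 𝒳 × 𝒳 → ℝ} (hμ : IsProbVec μ) (hμQ : ∀ a b, Q a b = 0 → μ (a, b) = 0)
    (hμk : ∀ a, fstMarg μ a < k * sndMarg μ a) {U : Set (𝒳 × 𝒳 → ℝ)} (hU : U ∈ nhds μ) {r : ℝ}
    (hr : r < -rate k Q μ) :
    ∀ᶠ n : ℕ in atTop, n ≡ 1 [MOD k] →
      Real.exp (r * n) ≤ mass k μ0 Q n {t | empPair t ∈ U} := by
  obtain ⟨c, hc⟩ : ∃ c, 0 < μ0 c := by
    by_contra! h
    have : ∑ a, μ0 a ≤ 0 := Finset.sum_nonpos fun a _ => h a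
    linarith
  obtain ⟨J, M, hM, hle, hJQ, hV, hJU, hrow⟩ :=
    exists_row hk hQ hμ hμQ hμk (interior_mem_nhds.2 hU) hr
  obtain ⟨B, w, hw, hB⟩ := exists_trees hk hQ hQ_sum hQ_irr hc hM hle (fun a b h =>
    (hQ a b).lt_of_ne fun h' => h.ne' (hJQ a b h'.symm)) hV
  set V : ℕ := ∑ a, ∑ b, J a b with hVdef
  have hV0 : (0 : ℝ) < V := by exact_mod_cast hV
  have hJV : ∀ a b, J a b ≤ V := fun a b =>
    (Finset.single_le_sum (f := fun b => J a b) (fun _ _ => Nat.zero_le _)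
      (Finset.mem_univ b)).trans
    (Finset.single_le_sum (f := fun a => ∑ b, J a b) (fun _ _ => Nat.zero_le _)
      (Finset.mem_univ a))
  obtain ⟨δ, hδ, hball⟩ := Metric.isOpen_iff.1 isOpen_interior _ hJU
  set R : ℝ := rowCount J M * rowWeight k Q J M with hR
  have hRpos : 0 < R := mul_pos (rowCount_pos _ _) (rowWeight_pos hk hQ hJQ _)
  set ρ : ℝ := Real.log R / V with hρ
  have hlarge : ∀ᶠ n : ℕ in atTop, B * |ρ| - Real.log w ≤ n * (ρ - r) :=
    ((tendsto_natCast_atTop_atTop (R := ℝ)).atTop_mul_const (sub_pos.2 hrow)).eventually_ge_atTop _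
  have hclose : ∀ᶠ n : ℕ in atTop, (2 * B + 1) / δ < (n : ℝ) - 1 := by
    filter_upwards [(tendsto_natCast_atTop_atTop (R := ℝ)).eventually_gt_atTop
      ((2 * B + 1) / δ + 1)] with n hn
    linarith
  filter_upwards [hlarge, hclose, eventually_ge_atTop B, eventually_ge_atTop 2]
    with n h1 h2 h3 h4 hmod
  obtain ⟨g, A, hg1, hg2, hcard, hA⟩ := hB n h3 hmod
  have hg1' : (g : ℝ) * V ≤ n := by exact_mod_cast hg1
  have hg2' : (n : ℝ) ≤ g * V + B := by exact_mod_cast hg2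
  have hn1 : (0 : ℝ) < (n : ℝ) - 1 := by
    have : (2 : ℝ) ≤ n := by exact_mod_cast h4
    linarith
  have hmass := card_mul_le_mass hk hμ0 hQ (n := n) (E := {t | empPair t ∈ U}) A
    (w := w * rowWeight k Q J M ^ g) (mul_pos hw (pow_pos (rowWeight_pos hk hQ hJQ _) _)) ?_
  · refine le_trans ?_ hmass
    have h5 : (A.card : ℝ) * (w * rowWeight k Q J M ^ g) = w * R ^ g := by
      rw [hcard, hR, mul_pow]; ring
    have h6 : R ^ g = Real.exp (g * V * ρ) := by
      rw [hρ, mul_assoc, mul_div_cancel₀ _ hV0.ne', Real.exp_nat_mul, Real.exp_log hRpos]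
    rw [h5, h6, ← Real.exp_log hw, ← Real.exp_add]
    refine Real.exp_le_exp.2 ?_
    have h7 : (n - g * V) * ρ ≤ B * |ρ| :=
      (mul_le_mul_of_nonneg_left (le_abs_self ρ) (by linarith)).trans
        (mul_le_mul_of_nonneg_right (by linarith) (abs_nonneg ρ))
    nlinarith
  · intro t ht
    obtain ⟨hs, hp, hwt⟩ := hA t ht
    refine ⟨hs, interior_subset (s := U) (hball ?_), hwt⟩
    rw [Metric.mem_ball, dist_pi_lt_iff hδ]
    rintro ⟨a, b⟩
    obtain ⟨p1, p2⟩ := hp a b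
    have p1' : (g : ℝ) * J a b ≤ pairCount t a b := by exact_mod_cast p1
    have p2' : (pairCount t a b : ℝ) ≤ g * J a b + B := by exact_mod_cast p2
    have hJV' : (J a b : ℝ) ≤ V := by exact_mod_cast hJV a b
    have hJ0 : (0 : ℝ) ≤ J a b := Nat.cast_nonneg _
    have hB0 : (0 : ℝ) ≤ B := Nat.cast_nonneg _
    rw [Real.dist_eq, empPair, hs, div_sub_div _ _ hn1.ne' hV0.ne', abs_div,
      abs_of_pos (mul_pos hn1 hV0), div_lt_iff₀ (mul_pos hn1 hV0)]
    rw [div_lt_iff₀ hδ] at h2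
    have h8 : |(pairCount t a b : ℝ) * V - (n - 1) * J a b| ≤ (2 * B + 1) * V := by
      rw [abs_le]
      constructor <;> nlinarith
    nlinarith

/-- Convex combination of two matrices. -/
def mix (ν μ : 𝒳 × 𝒳 → ℝ) (ε : ℝ) : 𝒳 × 𝒳 → ℝ := fun x => (1 - ε) * μ x + ε * ν x

theorem fstMarg_mix (ν μ : 𝒳 × 𝒳 → ℝ) (ε : ℝ) (a : 𝒳) :
    fstMarg (mix ν μ ε) a = (1 - ε) * fstMarg μ a + ε * fstMarg ν a := by
  simp only [fstMarg, mix, Finset.sum_add_distrib, Finset.mul_sum]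

theorem sndMarg_mix (ν μ : 𝒳 × 𝒳 → ℝ) (ε : ℝ) (a : 𝒳) :
    sndMarg (mix ν μ ε) a = (1 - ε) * sndMarg μ a + ε * sndMarg ν a := by
  simp only [sndMarg, mix, Finset.sum_add_distrib, Finset.mul_sum]

theorem tendsto_mix (ν μ : 𝒳 × 𝒳 → ℝ) :
    Tendsto (mix ν μ) (nhdsWithin 0 (Set.Ioo 0 1)) (nhds μ) := by
  have h : Continuous (mix ν μ) := by unfold mix; fun_prop
  have h2 := h.tendsto 0
  have h3 : mix ν μ 0 = μ := by ext; simp [mix]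
  rw [h3] at h2
  exact h2.mono_left nhdsWithin_le_nhds

instance neBot_nhdsWithin_Ioo_zero : (nhdsWithin (0 : ℝ) (Set.Ioo 0 1)).NeBot := by
  rw [nhdsWithin_Ioo_eq_nhdsGT zero_lt_one]
  infer_instance

theorem isProbVec_mix {ν μ : 𝒳 × 𝒳 → ℝ} (hν : IsProbVec ν) (hμ : IsProbVec μ) {ε : ℝ}
    (hε : ε ∈ Set.Ioo (0 : ℝ) 1) : IsProbVec (mix ν μ ε) := by
  refine ⟨fun x => add_nonneg (mul_nonneg (by linarith [hε.2]) (hμ.1 x))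
    (mul_nonneg hε.1.le (hν.1 x)), ?_⟩
  simp only [mix, Finset.sum_add_distrib, ← Finset.mul_sum, hμ.2, hν.2]
  ring

theorem fstMarg_mix_lt {k : ℕ} (hk : 2 ≤ k) {ν μ : 𝒳 × 𝒳 → ℝ}
    (hμ : ∀ a, fstMarg μ a ≤ k * sndMarg μ a) (hν : ∀ a, fstMarg ν a = sndMarg ν a)
    (hν0 : ∀ a, 0 < fstMarg ν a) {ε : ℝ} (hε : ε ∈ Set.Ioo (0 : ℝ) 1) (a : 𝒳) :
    fstMarg (mix ν μ ε) a < k * sndMarg (mix ν μ ε) a := by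
  have hk2 : (2 : ℝ) ≤ k := by exact_mod_cast hk
  rw [fstMarg_mix, sndMarg_mix, ← hν]
  have h1 := mul_le_mul_of_nonneg_left (hμ a) (sub_nonneg.2 hε.2.le)
  have h2 : ε * fstMarg ν a < ε * (k * fstMarg ν a) :=
    mul_lt_mul_of_pos_left (by nlinarith [hν0 a]) hε.1
  nlinarith

theorem exp_le_mass_of_feasible {k : ℕ} (hk : 2 ≤ k) {μ0 : 𝒳 → ℝ} (hμ0 : ∀ a, 0 ≤ μ0 a)
    (hμ0_sum : ∑ a, μ0 a = 1) {Q : 𝒳 → 𝒳 → ℝ} (hQ : ∀ a b, 0 ≤ Q a b)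
    (hQ_sum : ∀ a, ∑ b, Q a b = 1)
    (hQ_irr : ∀ a b, ∃ m : ℕ, 0 < ((Matrix.of Q) ^ (m + 1)) a b)
    {μ : 𝒳 × 𝒳 → ℝ} (hμ : IsProbVec μ) (hfeas : Feasible k Q μ)
    {U : Set (𝒳 × 𝒳 → ℝ)} (hU : U ∈ nhds μ) {r : ℝ} (hr : r < -rate k Q μ) :
    ∀ᶠ n : ℕ in atTop, n ≡ 1 [MOD k] →
      Real.exp (r * n) ≤ mass k μ0 Q n {t | empPair t ∈ U} := by
  have : Nonempty 𝒳 := by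
    by_contra h
    rw [not_nonempty_iff] at h
    simp at hμ0_sum
  obtain ⟨ν, hν, -, -, hνQ, hνm, hν0⟩ := exists_isProbVec_rate_eq_zero hk hQ hQ_sum hQ_irr
  have h1 := ((continuous_rate k Q).tendsto μ).neg.comp (tendsto_mix ν μ)
  obtain ⟨ε, hε, hr', hU'⟩ := (eventually_mem_nhdsWithin.and
    ((h1.eventually (lt_mem_nhds hr)).and
      ((tendsto_mix ν μ).eventually (eventually_mem_nhds_iff.2 hU)))).exists
  exact exp_le_mass_of_strict hk hμ0 hμ0_sum hQ hQ_sum hQ_irr (isProbVec_mix hν hμ hε)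
    (fun a b h => by simp [mix, hfeas.2 a b h, hνQ a b h]) (fstMarg_mix_lt hk hfeas.1 hνm hν0 hε)
    hU' hr'

theorem exp_le_mass_univ {k : ℕ} (hk : 2 ≤ k) {μ0 : 𝒳 → ℝ} (hμ0 : ∀ a, 0 ≤ μ0 a)
    (hμ0_sum : ∑ a, μ0 a = 1) {Q : 𝒳 → 𝒳 → ℝ} (hQ : ∀ a b, 0 ≤ Q a b)
    (hQ_sum : ∀ a, ∑ b, Q a b = 1)
    (hQ_irr : ∀ a b, ∃ m : ℕ, 0 < ((Matrix.of Q) ^ (m + 1)) a b) {r : ℝ} (hr : r < 0) :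
    ∀ᶠ n : ℕ in atTop, n ≡ 1 [MOD k] → Real.exp (r * n) ≤ mass k μ0 Q n Set.univ := by
  have : Nonempty 𝒳 := by
    by_contra h
    rw [not_nonempty_iff] at h
    simp at hμ0_sum
  have hk2 : (2 : ℝ) ≤ k := by exact_mod_cast hk
  obtain ⟨ν, hν, hr0, -, hνQ, hνm, hν0⟩ := exists_isProbVec_rate_eq_zero hk hQ hQ_sum hQ_irr
  exact exp_le_mass_of_strict hk hμ0 hμ0_sum hQ hQ_sum hQ_irr hν hνQ
    (fun a => by rw [← hνm]; nlinarith [hν0 a]) univ_mem (by rwa [hr0, neg_zero])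

/-- The test function attached to a kernel tilt `w`, an offspring tilt `v` and a potential `h`. -/
noncomputable def testFun (k : ℕ) (w : 𝒳 → 𝒳 → ℝ) (v h : 𝒳 → ℝ) (a b : 𝒳) : ℝ :=
  w a b + v a / k + h b - h a / k

theorem testFun_supersolution {k : ℕ} (hk : 2 ≤ k) {Q : 𝒳 → 𝒳 → ℝ} {w : 𝒳 → 𝒳 → ℝ} {v h : 𝒳 → ℝ}
    (hw : ∀ a, ∑ b, Q a b * Real.exp (w a b) = 1)
    (hvh : ∀ a, (1 - 1 / (k : ℝ)) * Real.exp (h a) + 1 / k * Real.exp (v a) ≤ 1) (a : 𝒳) :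
    1 - 1 / (k : ℝ) + 1 / k *
      (∑ b, Q a b * Real.exp (testFun k w v h a b) * Real.exp (-h b)) ^ k ≤ Real.exp (-h a) := by
  have hk0 : (k : ℝ) ≠ 0 := by positivity
  have h1 : ∑ b, Q a b * Real.exp (testFun k w v h a b) * Real.exp (-h b) =
      Real.exp (v a / k - h a / k) := by
    rw [← one_mul (Real.exp (v a / k - h a / k)), ← hw a, Finset.sum_mul]
    refine Finset.sum_congr rfl fun b _ => ?_
    rw [mul_assoc, mul_assoc, ← Real.exp_add, ← Real.exp_add, testFun]
    congr 2
    ring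
  have h2 : (k : ℝ) * (v a / k - h a / k) = v a + -h a := by field_simp; ring
  rw [h1, ← Real.exp_nat_mul, h2, Real.exp_add]
  have h3 := mul_le_mul_of_nonneg_right (hvh a) (Real.exp_pos (-h a)).le
  have h4 : Real.exp (h a) * Real.exp (-h a) = 1 := by rw [← Real.exp_add]; simp
  calc 1 - 1 / (k : ℝ) + 1 / k * (Real.exp (v a) * Real.exp (-h a))
      = (1 - 1 / (k : ℝ)) * (Real.exp (h a) * Real.exp (-h a)) +
        1 / k * (Real.exp (v a) * Real.exp (-h a)) := by rw [h4, mul_one]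
    _ = ((1 - 1 / (k : ℝ)) * Real.exp (h a) + 1 / k * Real.exp (v a)) * Real.exp (-h a) := by ring
    _ ≤ Real.exp (-h a) := by linarith

theorem sum_mul_testFun (k : ℕ) (w : 𝒳 → 𝒳 → ℝ) (v h : 𝒳 → ℝ) (μ : 𝒳 × 𝒳 → ℝ) :
    ∑ a, ∑ b, μ (a, b) * testFun k w v h a b =
      ∑ a, ∑ b, μ (a, b) * w a b +
        ∑ a, (fstMarg μ a / k * v a + (sndMarg μ a - fstMarg μ a / k) * h a) := by
  have h1 : ∑ a, ∑ b, μ (a, b) * h b = ∑ a, sndMarg μ a * h a := by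
    rw [Finset.sum_comm]
    simp only [sndMarg, Finset.sum_mul]
  have h2 : ∀ f : 𝒳 → ℝ, ∑ a, ∑ b, μ (a, b) * (f a / k) = ∑ a, fstMarg μ a / k * f a := fun f => by
    refine Finset.sum_congr rfl fun a _ => ?_
    rw [← Finset.sum_mul, fstMarg]
    ring
  simp only [testFun, mul_sub, mul_add, Finset.sum_sub_distrib, Finset.sum_add_distrib, h1, h2,
    sub_mul]
  ring

/-- The rate functional with the logarithms evaluated at another matrix. -/
noncomputable def crossRate (k : ℕ) (Q : 𝒳 → 𝒳 → ℝ) (μ η : 𝒳 × 𝒳 → ℝ) : ℝ :=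
  ∑ a, ∑ b, (μ (a, b) * Real.log (η (a, b)) - μ (a, b) * Real.log (Q a b)) +
    ∑ a, (fstMarg μ a / k * Real.log (fstMarg η a / k) +
      (sndMarg μ a - fstMarg μ a / k) * Real.log (sndMarg η a - fstMarg η a / k) -
      fstMarg μ a * Real.log (fstMarg η a) - sndMarg μ a * Real.log (sndMarg η a) +
      fstMarg μ a / k * Real.log k -
      (sndMarg μ a - fstMarg μ a / k) * Real.log (1 - 1 / (k : ℝ)))

theorem tendsto_mul_log {ι : Type*} {l : Filter ι} {f : ι → ℝ} {x : ℝ} (hf : Tendsto f l (nhds x)) :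
    Tendsto (fun i => x * Real.log (f i)) l (nhds (x * Real.log x)) := by
  rcases eq_or_ne x 0 with rfl | hx
  · simpa using tendsto_const_nhds
  · exact (hf.log hx).const_mul x

theorem tendsto_crossRate (k : ℕ) (Q : 𝒳 → 𝒳 → ℝ) (μ : 𝒳 × 𝒳 → ℝ) :
    Tendsto (crossRate k Q μ) (nhds μ) (nhds (rate k Q μ)) := by
  have h : ∀ f : (𝒳 × 𝒳 → ℝ) → ℝ, Continuous f →
      Tendsto (fun η => f μ * Real.log (f η)) (nhds μ) (nhds (f μ * Real.log (f μ))) :=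
    fun f hf => tendsto_mul_log (hf.tendsto μ)
  unfold crossRate rate
  refine Tendsto.add (tendsto_finsetSum _ fun a _ => tendsto_finsetSum _ fun b _ => ?_)
    (tendsto_finsetSum _ fun a _ => ?_)
  · exact (h (fun η => η (a, b)) (by fun_prop)).sub tendsto_const_nhds
  · exact (((((h (fun η => fstMarg η a / k) (by fun_prop)).add
      (h (fun η => sndMarg η a - fstMarg η a / k) (by fun_prop))).sub
      (h (fun η => fstMarg η a) (by fun_prop))).sub
      (h (fun η => sndMarg η a) (by fun_prop))).add tendsto_const_nhds).sub tendsto_const_nhds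

theorem exists_testFun_eq_crossRate {k : ℕ} (hk : 2 ≤ k) {Q : 𝒳 → 𝒳 → ℝ} (hQ : ∀ a b, 0 ≤ Q a b)
    {μ η : 𝒳 × 𝒳 → ℝ} (hμ : ∀ a b, Q a b = 0 → μ (a, b) = 0)
    (hη : ∀ a b, Q a b ≠ 0 → 0 < η (a, b)) (hηQ : ∀ a b, Q a b = 0 → η (a, b) = 0)
    (hη1 : ∀ a, 0 < fstMarg η a) (hη2 : ∀ a, fstMarg η a < k * sndMarg η a) :
    ∃ w v h, (∀ a, ∑ b, Q a b * Real.exp (w a b) = 1) ∧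
      (∀ a, (1 - 1 / (k : ℝ)) * Real.exp (h a) + 1 / k * Real.exp (v a) ≤ 1) ∧
      ∑ a, ∑ b, μ (a, b) * testFun k w v h a b = crossRate k Q μ η := by
  have hk0 : (0 : ℝ) < k := by positivity
  have hkp := karyLaw_zero_pos hk
  have hs : ∀ a, 0 < sndMarg η a := fun a =>
    pos_of_mul_pos_right ((hη1 a).trans (hη2 a)) hk0.le
  have hd : ∀ a, 0 < sndMarg η a - fstMarg η a / k := fun a => by
    rw [sub_pos, div_lt_iff₀' hk0]; exact hη2 a
  refine ⟨fun a b => Real.log (η (a, b) / (fstMarg η a * Q a b)),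
    fun a => Real.log (fstMarg η a / sndMarg η a),
    fun a => Real.log ((sndMarg η a - fstMarg η a / k) / (sndMarg η a * (1 - 1 / (k : ℝ)))),
    fun a => ?_, fun a => ?_, ?_⟩
  · have h1 : ∀ b, Q a b * Real.exp (Real.log (η (a, b) / (fstMarg η a * Q a b))) =
        η (a, b) / fstMarg η a := fun b => by
      rcases eq_or_ne (Q a b) 0 with h0 | h0
      · simp [h0, hηQ a b h0]
      · have h2 := (hη1 a).ne'
        have h3 : 0 < Q a b := (hQ a b).lt_of_ne h0.symm
        rw [Real.exp_log (div_pos (hη a b h0) (mul_pos (hη1 a) h3))]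
        field_simp
    simp only [h1, ← Finset.sum_div]
    exact div_self (hη1 a).ne'
  · rw [Real.exp_log (div_pos (hd a) (mul_pos (hs a) hkp)),
      Real.exp_log (div_pos (hη1 a) (hs a))]
    have h2 := (hs a).ne'
    have h3 := hkp.ne'
    refine le_of_eq ?_
    rw [mul_div_assoc', mul_comm (sndMarg η a), mul_div_mul_left _ _ h3]
    field_simp
    ring
  · rw [sum_mul_testFun, crossRate, ← Finset.sum_add_distrib, ← Finset.sum_add_distrib]
    refine Finset.sum_congr rfl fun a _ => ?_
    have r1 : ∑ b, μ (a, b) * Real.log (η (a, b) / (fstMarg η a * Q a b)) =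
        ∑ b, (μ (a, b) * Real.log (η (a, b)) - μ (a, b) * Real.log (Q a b)) -
          fstMarg μ a * Real.log (fstMarg η a) := by
      rw [fstMarg.eq_def μ, Finset.sum_mul, ← Finset.sum_sub_distrib]
      refine Finset.sum_congr rfl fun b _ => ?_
      rcases eq_or_ne (Q a b) 0 with h0 | h0
      · simp [hμ a b h0]
      · rw [Real.log_div (hη a b h0).ne' (mul_ne_zero (hη1 a).ne' h0),
          Real.log_mul (hη1 a).ne' h0]
        ring
    rw [r1, Real.log_div (hη1 a).ne' (hs a).ne', Real.log_div (hd a).ne'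
      (mul_pos (hs a) hkp).ne', Real.log_mul (hs a).ne' hkp.ne', Real.log_div (hη1 a).ne' hk0.ne']
    ring

theorem exists_supersolution {k : ℕ} (hk : 2 ≤ k) {Q : 𝒳 → 𝒳 → ℝ} (hQ : ∀ a b, 0 ≤ Q a b)
    (hQ_sum : ∀ a, ∑ b, Q a b = 1)
    (hQ_irr : ∀ a b, ∃ m : ℕ, 0 < ((Matrix.of Q) ^ (m + 1)) a b)
    {μ : 𝒳 × 𝒳 → ℝ} (hμ : IsProbVec μ) {c : ℝ} (hc : (c : EReal) < rateKary k Q μ) :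
    ∃ (g : 𝒳 → 𝒳 → ℝ) (y : 𝒳 → ℝ), (∀ a, 0 ≤ y a) ∧
      (∀ a, 1 - 1 / (k : ℝ) + 1 / k * (∑ b, Q a b * Real.exp (g a b) * y b) ^ k ≤ y a) ∧
      c < ∑ a, ∑ b, μ (a, b) * g a b := by
  have hk0 : (0 : ℝ) < k := by positivity
  suffices h : ∃ (w : 𝒳 → 𝒳 → ℝ) (v h : 𝒳 → ℝ), (∀ a, ∑ b, Q a b * Real.exp (w a b) = 1) ∧
      (∀ a, (1 - 1 / (k : ℝ)) * Real.exp (h a) + 1 / k * Real.exp (v a) ≤ 1) ∧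
      c < ∑ a, ∑ b, μ (a, b) * testFun k w v h a b by
    obtain ⟨w, v, h, hw, hvh, hlt⟩ := h
    exact ⟨testFun k w v h, fun a => Real.exp (-h a), fun a => (Real.exp_pos _).le,
      testFun_supersolution hk hw hvh, hlt⟩
  by_cases h1 : ∀ a b, Q a b = 0 → μ (a, b) = 0
  swap
  · push Not at h1
    obtain ⟨a0, b0, hq, hne⟩ := h1
    have hpos : 0 < μ (a0, b0) := (hμ.1 _).lt_of_ne hne.symm
    refine ⟨fun a b => if a = a0 ∧ b = b0 then (c + 1) / μ (a0, b0) else 0, 0, 0, fun a => ?_,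
      fun a => by simp, ?_⟩
    · refine (Finset.sum_congr rfl fun b _ => ?_).trans (hQ_sum a)
      by_cases h : a = a0 ∧ b = b0
      · rw [h.1, h.2, hq, zero_mul]
      · simp [h]
    · rw [sum_mul_testFun]
      simp [ite_and, mul_div_cancel₀ _ hpos.ne']
  by_cases h2 : ∀ a, fstMarg μ a ≤ k * sndMarg μ a
  swap
  · push Not at h2
    obtain ⟨a0, ha0⟩ := h2
    have hpos : 0 < fstMarg μ a0 / k - sndMarg μ a0 := by
      rw [sub_pos, lt_div_iff₀' hk0]; exact ha0
    refine ⟨0, 0, fun a => if a = a0 then -((|c| + 1) / (fstMarg μ a0 / k - sndMarg μ a0)) else 0,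
      fun a => by simp [hQ_sum], fun a => ?_, ?_⟩
    · have h3 : Real.exp (if a = a0 then -((|c| + 1) / (fstMarg μ a0 / k - sndMarg μ a0)) else 0)
          ≤ 1 := by
        rw [Real.exp_le_one_iff]
        split_ifs
        · rw [neg_nonpos]; positivity
        · exact le_rfl
      have h4 := mul_le_mul_of_nonneg_left h3 (karyLaw_zero_pos hk).le
      simp only [Pi.zero_apply, Real.exp_zero]
      linarith
    · rw [sum_mul_testFun]
      simp only [Pi.zero_apply, mul_zero, Finset.sum_const_zero, zero_add, mul_ite,
        Finset.sum_ite_eq', Finset.mem_univ, if_true]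
      have h5 : (sndMarg μ a0 - fstMarg μ a0 / k) *
          -((|c| + 1) / (fstMarg μ a0 / k - sndMarg μ a0)) = |c| + 1 := by
        rw [← neg_sub, neg_mul_neg, mul_div_cancel₀ _ hpos.ne']
      rw [h5]
      linarith [le_abs_self c]
  · have hne : Nonempty 𝒳 := by
      by_contra h
      rw [not_nonempty_iff] at h
      simpa using hμ.2
    obtain ⟨ν, hν, -, hνpos, hνQ, hνm, hν0⟩ := exists_isProbVec_rate_eq_zero hk hQ hQ_sum hQ_irr
    rw [rateKary_of_feasible hk hQ hQ_sum hμ ⟨h2, h1⟩, EReal.coe_lt_coe_iff] at hc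
    have h3 := (tendsto_crossRate k Q μ).comp (tendsto_mix ν μ)
    obtain ⟨ε, hε, hlt⟩ := (eventually_mem_nhdsWithin.and
      (h3.eventually (lt_mem_nhds hc))).exists
    have hε1 : 0 < 1 - ε := sub_pos.2 hε.2
    obtain ⟨w, v, h, hw, hvh, heq⟩ := exists_testFun_eq_crossRate hk hQ (μ := μ) (η := mix ν μ ε) h1
      (fun a b hab => add_pos_of_nonneg_of_pos (mul_nonneg hε1.le (hμ.1 _))
        (mul_pos hε.1 (hνpos a b ((hQ a b).lt_of_ne hab.symm))))
      (fun a b hab => by simp [mix, h1 a b hab, hνQ a b hab])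
      (fun a => by
        rw [fstMarg_mix]
        exact add_pos_of_nonneg_of_pos (mul_nonneg hε1.le (fstMarg_nonneg hμ.1 a))
          (mul_pos hε.1 (hν0 a)))
      (fstMarg_mix_lt hk h2 hνm hν0 hε)
    exact ⟨w, v, h, hw, hvh, heq ▸ hlt⟩

/-- The event that the empirical pair measure lies in `F`. -/
def empEvent (F : Set (PV 𝒳)) : Set (PTree 𝒳) :=
  {t | ∃ h : IsProbVec (empPair t), (⟨empPair t, h⟩ : PV 𝒳) ∈ F}

theorem mass_empEvent_le {k : ℕ} (hk : 2 ≤ k) {μ0 : 𝒳 → ℝ} (hμ0 : ∀ a, 0 ≤ μ0 a)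
    {Q : 𝒳 → 𝒳 → ℝ} (hQ : ∀ a b, 0 ≤ Q a b) (hQ_sum : ∀ a, ∑ b, Q a b = 1)
    (hQ_irr : ∀ a b, ∃ m : ℕ, 0 < ((Matrix.of Q) ^ (m + 1)) a b)
    {F : Set (PV 𝒳)} (hF : IsClosed F) {c : ℝ}
    (hc : ∀ μ ∈ F, (c : EReal) < rateKary k Q μ.1) :
    ∃ K : ℝ, ∀ n, 2 ≤ n → mass k μ0 Q n (empEvent F) ≤ K * Real.exp (-(c * (n - 1))) := by
  refine hF.isCompact.induction_on
    (p := fun F => ∃ K : ℝ, ∀ n, 2 ≤ n →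
      mass k μ0 Q n (empEvent F) ≤ K * Real.exp (-(c * (n - 1)))) ?_ ?_ ?_ ?_
  · refine ⟨0, fun n _ => ?_⟩
    simp [empEvent, mass]
  · rintro s t hst ⟨K, hK⟩
    refine ⟨K, fun n hn => le_trans (mass_mono hk hμ0 hQ ?_) (hK n hn)⟩
    rintro x - ⟨h, h'⟩
    exact ⟨h, hst h'⟩
  · rintro s t ⟨K, hK⟩ ⟨K', hK'⟩
    refine ⟨K + K', fun n hn => ?_⟩
    have h1 : empEvent (s ∪ t) = empEvent s ∪ empEvent t := by
      ext x
      simp only [empEvent, Set.mem_union, Set.mem_ofPred_eq]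
      constructor
      · rintro ⟨h, h1 | h1⟩
        exacts [Or.inl ⟨h, h1⟩, Or.inr ⟨h, h1⟩]
      · rintro (⟨h, h1⟩ | ⟨h, h1⟩)
        exacts [⟨h, Or.inl h1⟩, ⟨h, Or.inr h1⟩]
    rw [h1, add_mul]
    exact (mass_union_le hk hμ0 hQ n _ _).trans (add_le_add (hK n hn) (hK' n hn))
  · intro μ hμ
    obtain ⟨g, y, hy0, hy, hlt⟩ := exists_supersolution hk hQ hQ_sum hQ_irr μ.2 (hc μ hμ)
    let U : Set (PV 𝒳) := {μ' | c < ∑ a, ∑ b, μ'.1 (a, b) * g a b}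
    have hU : IsOpen U := isOpen_lt continuous_const <|
      continuous_finsetSum _ fun a _ => continuous_finsetSum _ fun b _ =>
        ((continuous_apply (a, b)).comp continuous_subtype_val).mul continuous_const
    refine ⟨U, mem_nhdsWithin_of_mem_nhds (hU.mem_nhds hlt), ∑ a, μ0 a * y a, fun n hn => ?_⟩
    refine le_trans ?_ (mass_halfSpace_le hk hμ0 hQ g y hy0 hy n (c * (n - 1)))
    refine mass_mono hk hμ0 hQ ?_
    rintro t rfl ⟨h, hU'⟩
    have h2 : (2 : ℝ) ≤ t.size := by exact_mod_cast hn
    rw [Set.mem_ofPred_eq, sum_empPair_mul g t hn, mul_comm c]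
    exact mul_le_mul_of_nonneg_left (le_of_lt hU') (by linarith)

theorem elog_ofReal_le {x r : ℝ} (h : x ≤ Real.exp r) : elog (ENNReal.ofReal x) ≤ (r : EReal) := by
  unfold elog
  rcases le_or_gt x 0 with h0 | h0
  · simp [ENNReal.ofReal_eq_zero.2 h0]
  · rw [if_neg (by simpa using h0), if_neg ENNReal.ofReal_ne_top, ENNReal.toReal_ofReal h0.le,
      EReal.coe_le_coe_iff, ← Real.log_exp r]
    exact Real.log_le_log h0 h

theorem le_elog_ofReal {x r : ℝ} (h : Real.exp r ≤ x) : (r : EReal) ≤ elog (ENNReal.ofReal x) := by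
  have h0 : 0 < x := (Real.exp_pos r).trans_le h
  unfold elog
  rw [if_neg (by simpa using h0), if_neg ENNReal.ofReal_ne_top, ENNReal.toReal_ofReal h0.le,
    EReal.coe_le_coe_iff, ← Real.log_exp r]
  exact Real.log_le_log (Real.exp_pos r) h

theorem inv_mul_le_of_le_mul {n : ℕ} (hn : 0 < n) {e : EReal} {r : ℝ}
    (h : e ≤ ((r * n : ℝ) : EReal)) : (((n : ℝ)⁻¹ : ℝ) : EReal) * e ≤ r := by
  have hn' : (n : ℝ) ≠ 0 := by positivity
  refine (mul_le_mul_of_nonneg_left h (EReal.coe_nonneg.2 (by positivity))).trans_eq ?_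
  rw [← EReal.coe_mul]
  congr 1
  field_simp

theorem le_inv_mul_of_mul_le {n : ℕ} (hn : 0 < n) {e : EReal} {r : ℝ}
    (h : ((r * n : ℝ) : EReal) ≤ e) : (r : EReal) ≤ (((n : ℝ)⁻¹ : ℝ) : EReal) * e := by
  have hn' : (n : ℝ) ≠ 0 := by positivity
  refine le_trans (le_of_eq ?_)
    (mul_le_mul_of_nonneg_left h (EReal.coe_nonneg.2 (by positivity)))
  rw [← EReal.coe_mul]
  congr 1
  field_simp

theorem modEq_of_mem_sizeSupport {k : ℕ} (hk : 2 ≤ k) {μ0 : 𝒳 → ℝ} (hμ0 : ∀ a, 0 ≤ μ0 a)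
    {Q : 𝒳 → 𝒳 → ℝ} (hQ : ∀ a b, 0 ≤ Q a b) {n : ℕ}
    (hn : n ∈ sizeSupport (jointWeight (karyLaw k) μ0 Q)) : n ≡ 1 [MOD k] := by
  have h : 0 < treeMass (jointWeight (karyLaw k) μ0 Q) n := hn
  rw [treeMass_eq hk hμ0 hQ, ENNReal.ofReal_pos, mass] at h
  obtain ⟨t, ht, hne⟩ := Finset.exists_ne_zero_of_sum_ne_zero h.ne'
  rw [jointWeight_eq] at hne
  simp only [Finset.mem_filter] at ht
  rw [← ht.2.1]
  exact size_modEq t (right_ne_zero_of_mul hne)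

theorem limsup_elog_condP_le {k : ℕ} (hk : 2 ≤ k) {μ0 : 𝒳 → ℝ} (hμ0 : ∀ a, 0 ≤ μ0 a)
    (hμ0_sum : ∑ a, μ0 a = 1) {Q : 𝒳 → 𝒳 → ℝ} (hQ : ∀ a b, 0 ≤ Q a b)
    (hQ_sum : ∀ a, ∑ b, Q a b = 1)
    (hQ_irr : ∀ a b, ∃ m : ℕ, 0 < ((Matrix.of Q) ^ (m + 1)) a b)
    {F : Set (PV 𝒳)} (hF : IsClosed F) :
    limsup (fun n : ℕ => (((n : ℝ)⁻¹ : ℝ) : EReal) *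
        elog (condP (jointWeight (karyLaw k) μ0 Q) n (empEvent F)))
      (atTop ⊓ Filter.principal (sizeSupport (jointWeight (karyLaw k) μ0 Q)))
      ≤ -⨅ μ ∈ F, rateKary k Q μ.1 := by
  refine le_of_forall_gt fun b hb => ?_
  obtain ⟨b2, hb2, hb2'⟩ := EReal.lt_iff_exists_real_btwn.1 hb
  obtain ⟨b1, hb1, hb1'⟩ := EReal.lt_iff_exists_real_btwn.1 hb2
  rw [EReal.coe_lt_coe_iff] at hb1'
  refine lt_of_le_of_lt ?_ hb2'
  have hc : ∀ μ ∈ F, ((-b1 : ℝ) : EReal) < rateKary k Q μ.1 := fun μ hμ => by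
    rw [EReal.coe_neg]
    exact (EReal.neg_lt_comm.1 hb1).trans_le (iInf₂_le μ hμ)
  obtain ⟨K, hK⟩ := mass_empEvent_le hk hμ0 hQ hQ_sum hQ_irr hF hc
  have hδ : 0 < (b2 - b1) / 2 := by linarith
  refine limsup_le_of_le (by isBoundedDefault) ?_
  rw [eventually_inf_principal]
  have hlarge : ∀ᶠ n : ℕ in atTop, Real.log (|K| + 1) - b1 ≤ n * ((b2 - b1) / 2) :=
    ((tendsto_natCast_atTop_atTop (R := ℝ)).atTop_mul_const hδ).eventually_ge_atTop _
  filter_upwards [exp_le_mass_univ hk hμ0 hμ0_sum hQ hQ_sum hQ_irr (neg_lt_zero.2 hδ),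
    eventually_ge_atTop 2, hlarge] with n h1 h2 h3 hS
  have h4 := h1 (modEq_of_mem_sizeSupport hk hμ0 hQ hS)
  have hpos := (Real.exp_pos _).trans_le h4
  refine inv_mul_le_of_le_mul (by omega) ?_
  rw [condP_eq hk hμ0 hQ, ← ENNReal.ofReal_div_of_pos hpos]
  refine elog_ofReal_le ?_
  rw [div_le_iff₀ hpos]
  have hK1 : 0 < |K| + 1 := by positivity
  calc mass k μ0 Q n (empEvent F) ≤ K * Real.exp (-(-b1 * (n - 1))) := hK n h2
    _ ≤ (|K| + 1) * Real.exp (-(-b1 * (n - 1))) :=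
      mul_le_mul_of_nonneg_right (by linarith [le_abs_self K]) (Real.exp_pos _).le
    _ = Real.exp (Real.log (|K| + 1) + -(-b1 * (n - 1))) := by rw [Real.exp_add, Real.exp_log hK1]
    _ ≤ Real.exp (b2 * n + -((b2 - b1) / 2) * n) := Real.exp_le_exp.2 (by nlinarith)
    _ = Real.exp (b2 * n) * Real.exp (-((b2 - b1) / 2) * n) := Real.exp_add _ _
    _ ≤ Real.exp (b2 * n) * mass k μ0 Q n Set.univ :=
      mul_le_mul_of_nonneg_left h4 (Real.exp_pos _).le

theorem le_liminf_elog_condP {k : ℕ} (hk : 2 ≤ k) {μ0 : 𝒳 → ℝ} (hμ0 : ∀ a, 0 ≤ μ0 a)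
    (hμ0_sum : ∑ a, μ0 a = 1) {Q : 𝒳 → 𝒳 → ℝ} (hQ : ∀ a b, 0 ≤ Q a b)
    (hQ_sum : ∀ a, ∑ b, Q a b = 1)
    (hQ_irr : ∀ a b, ∃ m : ℕ, 0 < ((Matrix.of Q) ^ (m + 1)) a b)
    {O : Set (PV 𝒳)} (hO : IsOpen O) :
    -⨅ μ ∈ O, rateKary k Q μ.1 ≤
      liminf (fun n : ℕ => (((n : ℝ)⁻¹ : ℝ) : EReal) *
        elog (condP (jointWeight (karyLaw k) μ0 Q) n (empEvent O)))
      (atTop ⊓ Filter.principal (sizeSupport (jointWeight (karyLaw k) μ0 Q))) := by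
  refine le_of_forall_lt fun b hb => ?_
  obtain ⟨r, hr, hr'⟩ := EReal.lt_iff_exists_real_btwn.1 hb
  refine lt_of_lt_of_le hr ?_
  obtain ⟨μ, hμO, hμ⟩ : ∃ μ ∈ O, rateKary k Q μ.1 < -(r : EReal) := by
    have := EReal.lt_neg_comm.1 hr'
    simpa only [iInf_lt_iff, exists_prop] using this
  have hfeas : Feasible k Q μ.1 := by
    by_contra h
    rw [rateKary_of_not_feasible hk h] at hμ
    exact not_top_lt hμ
  rw [rateKary_of_feasible hk hQ hQ_sum μ.2 hfeas, ← EReal.coe_neg, EReal.coe_lt_coe_iff] at hμ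
  obtain ⟨U, hU, hUO⟩ := isOpen_induced_iff.1 hO
  have hUμ : U ∈ nhds μ.1 := hU.mem_nhds (by rw [← hUO] at hμO; exact hμO)
  refine le_liminf_of_le (by isBoundedDefault) ?_
  rw [eventually_inf_principal]
  filter_upwards [exp_le_mass_of_feasible hk hμ0 hμ0_sum hQ hQ_sum hQ_irr μ.2 hfeas hUμ
    (by linarith), eventually_ge_atTop 2] with n h1 h2 hS
  refine le_inv_mul_of_mul_le (by omega) ?_
  have h3 : Real.exp (r * n) ≤ mass k μ0 Q n (empEvent O) :=
    (h1 (modEq_of_mem_sizeSupport hk hμ0 hQ hS)).trans <| mass_mono hk hμ0 hQ <| by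
      rintro t rfl ht
      refine ⟨isProbVec_empPair h2, ?_⟩
      rw [← hUO]
      exact ht
  have h4 : mass k μ0 Q n (empEvent O) ≤ mass k μ0 Q n Set.univ :=
    mass_mono hk hμ0 hQ fun _ _ _ => Set.mem_univ _
  have hpos := (Real.exp_pos (r * n)).trans_le (h3.trans h4)
  rw [condP_eq hk hμ0 hQ, ← ENNReal.ofReal_div_of_pos hpos]
  refine le_elog_ofReal (h3.trans ?_)
  rw [le_div_iff₀ hpos]
  exact mul_le_of_le_one_right (mass_nonneg hk hμ0 hQ n _)
    (mass_le_one hk hμ0 hμ0_sum hQ hQ_sum n _)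

theorem tsum_karyLaw {k : ℕ} (hk : 2 ≤ k) (s : ℝ) :
    ∑' n : ℕ, karyLaw k n * Real.exp (s * n) = 1 - 1 / (k : ℝ) + 1 / k * Real.exp (s * k) := by
  have hk0 : k ≠ 0 := by omega
  rw [tsum_eq_sum (s := {0, k})]
  · rw [Finset.sum_pair hk0.symm, karyLaw_self, karyLaw_zero hk]
    simp
  · intro n hn
    simp only [Finset.mem_insert, Finset.mem_singleton, not_or] at hn
    simp [karyLaw, hn.1, hn.2]

theorem mul_log_div_le {s y : ℝ} (hs : 0 ≤ s) (hy : 0 < y) : s * Real.log y ≤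
    s * Real.log s + y - s := by
  rcases hs.eq_or_lt with rfl | hs
  · simpa using hy.le
  · have h := Real.log_le_sub_one_of_pos (div_pos hy hs)
    rw [Real.log_div hy.ne' hs.ne'] at h
    have h2 : s * (y / s - 1) = y - s := by field_simp
    nlinarith

theorem cramerRate_karyLaw {k : ℕ} (hk : 2 ≤ k) {x : ℝ} (hx0 : 0 ≤ x) (hxk : x ≤ k) :
    cramerRate (karyLaw k) x = ((x / k * Real.log x
      + (1 - x / k) * Real.log ((1 - x / k) / (1 - 1 / k)) : ℝ) : EReal) := by
  have hk0 : (0 : ℝ) < k := by positivity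
  have hp := karyLaw_zero_pos hk
  set p : ℝ := 1 - 1 / (k : ℝ) with hpdef
  have hs0 : 0 ≤ x / k := by positivity
  have hs1 : 0 ≤ 1 - x / k := sub_nonneg.2 ((div_le_one hk0).2 hxk)
  simp only [cramerRate, tsum_karyLaw hk]
  have hsplit : (1 - x / k) * Real.log ((1 - x / k) / p) =
      (1 - x / k) * Real.log (1 - x / k) - (1 - x / k) * Real.log p := by
    rcases eq_or_ne (1 - x / k) 0 with h0 | h0
    · simp [h0]
    · rw [Real.log_div h0 hp.ne']; ring
  have hsx : x / k * Real.log (x / k) = x / k * Real.log x - x / k * Real.log k := by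
    rcases eq_or_ne x 0 with h0 | h0
    · simp [h0]
    · rw [Real.log_div h0 hk0.ne']; ring
  refine le_antisymm (iSup_le fun s => EReal.coe_le_coe_iff.2 ?_) ?_
  · set Z : ℝ := p + 1 / k * Real.exp (s * k) with hZ
    have hZ0 : 0 < Z := by positivity
    have h1 := mul_log_div_le hs0 (show 0 < 1 / k * Real.exp (s * k) / Z by positivity)
    have h2 := mul_log_div_le hs1 (show 0 < p / Z by positivity)
    rw [Real.log_div (by positivity) hZ0.ne', Real.log_mul (by positivity) (by positivity),
      one_div, Real.log_inv, Real.log_exp] at h1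
    rw [Real.log_div hp.ne' hZ0.ne'] at h2
    have h3 : (k : ℝ)⁻¹ * Real.exp (s * k) / Z + p / Z = 1 := by
      rw [← add_div, add_comm, ← one_div]
      exact div_self hZ0.ne'
    have h4 : x / k * (s * k) = s * x := by field_simp
    rw [hsplit]
    nlinarith
  · refine le_of_forall_lt fun b hb => ?_
    have hlim : Tendsto (fun ε : ℝ => x / k * Real.log ((1 - ε) * x + ε) +
        ((1 - x / k) * Real.log (1 - ((1 - ε) * x + ε) / k) - (1 - x / k) * Real.log p))
        (nhdsWithin 0 (Set.Ioo 0 1))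
        (nhds (x / k * Real.log x + (1 - x / k) * Real.log ((1 - x / k) / p))) := by
      rw [hsplit]
      have hc : Tendsto (fun ε : ℝ => (1 - ε) * x + ε) (nhdsWithin 0 (Set.Ioo 0 1)) (nhds x) := by
        have : Continuous fun ε : ℝ => (1 - ε) * x + ε := by fun_prop
        simpa using (this.tendsto 0).mono_left nhdsWithin_le_nhds
      refine Tendsto.add ?_ (Tendsto.sub ?_ tendsto_const_nhds)
      · have := (tendsto_mul_log hc).const_mul (1 / (k : ℝ))
        convert this using 2 <;> ring
      · exact tendsto_mul_log ((hc.div_const _).const_sub 1)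
    have hev := (continuous_coe_real_ereal.tendsto _).comp hlim
    obtain ⟨ε, hε, hlt⟩ := (eventually_mem_nhdsWithin.and
      (hev.eventually (lt_mem_nhds hb))).exists
    refine lt_of_lt_of_le hlt ?_
    set z : ℝ := (1 - ε) * x + ε with hz
    have hk2 : (2 : ℝ) ≤ k := by exact_mod_cast hk
    have hz0 : 0 < z := add_pos_of_nonneg_of_pos (mul_nonneg (by linarith [hε.2]) hx0) hε.1
    have hzk : 0 < 1 - z / k := by
      rw [sub_pos, div_lt_one hk0]
      have h5 := mul_le_mul_of_nonneg_left hxk (sub_nonneg.2 hε.2.le)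
      nlinarith [hε.1]
    refine le_trans (le_of_eq ?_) (le_iSup _ (Real.log (z * p / (1 - z / k)) / k))
    simp only [Function.comp, ← hz]
    congr 1
    have h6 : p + 1 / k * Real.exp (Real.log (z * p / (1 - z / k)) / k * k) = p / (1 - z / k) := by
      rw [div_mul_cancel₀ _ hk0.ne', Real.exp_log (by positivity)]
      have := hzk.ne'
      generalize hd : 1 - z / k = d at *
      have h7 : z / k = 1 - d := by linarith
      have h8 : 1 / k * (z * p / d) = z / k * p / d := by ring
      rw [h8, h7]
      field_simp
      ring
    rw [h6, Real.log_div (by positivity) hzk.ne', Real.log_div hp.ne' hzk.ne',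
      Real.log_mul hz0.ne' hp.ne']
    generalize Real.log (1 - z / k) = d
    field_simp
    ring

end KaryTree

theorem kary_cramer_rate_and_ldp_empirical_pair_measure
    (k : ℕ) (hk : 2 ≤ k)
    (μ0 : 𝒳 → ℝ) (hμ0_nonneg : ∀ a, 0 ≤ μ0 a) (hμ0_sum : ∑ a, μ0 a = 1)
    (Q : 𝒳 → 𝒳 → ℝ) (hQ_nonneg : ∀ a b, 0 ≤ Q a b) (hQ_sum : ∀ a, ∑ b, Q a b = 1)
    (hQ_irr : ∀ a b, ∃ m : ℕ, 0 < ((Matrix.of Q) ^ (m + 1)) a b)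
    (I : PV 𝒳 → EReal) (hI : ∀ μ, I μ = rateKary k Q μ.1)
    (S : Set ℕ) (hS : S = sizeSupport (jointWeight (karyLaw k) μ0 Q)) :
    -- the explicit form of the Cramér rate function of `karyLaw k`
    (∀ x : ℝ, 0 ≤ x → x ≤ k →
      cramerRate (karyLaw k) x =
        ((x / k * Real.log x
          + (1 - x / k) * Real.log ((1 - x / k) / (1 - 1 / k)) : ℝ) : EReal)) ∧
    -- `I` is a good rate function
    LowerSemicontinuous I ∧
    (∀ c : ℝ, IsCompact {μ : PV 𝒳 | I μ ≤ (c : EReal)}) ∧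
    -- large deviation upper bound, conditionally on `{|T| = n}`, along `n ∈ S`
    (∀ F : Set (PV 𝒳), IsClosed F →
      Filter.limsup
        (fun n : ℕ => (((n : ℝ)⁻¹ : ℝ) : EReal) *
          elog (condP (jointWeight (karyLaw k) μ0 Q) n
            {t | ∃ h : IsProbVec (empPair t), (⟨empPair t, h⟩ : PV 𝒳) ∈ F}))
        (Filter.atTop ⊓ Filter.principal S)
        ≤ - ⨅ μ ∈ F, I μ) ∧
    -- large deviation lower bound
    (∀ O : Set (PV 𝒳), IsOpen O →
      - ⨅ μ ∈ O, I μ ≤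
      Filter.liminf
        (fun n : ℕ => (((n : ℝ)⁻¹ : ℝ) : EReal) *
          elog (condP (jointWeight (karyLaw k) μ0 Q) n
            {t | ∃ h : IsProbVec (empPair t), (⟨empPair t, h⟩ : PV 𝒳) ∈ O}))
        (Filter.atTop ⊓ Filter.principal S)) := by
  subst hS
  obtain rfl : I = fun μ : PV 𝒳 => rateKary k Q μ.1 := funext hI
  have hlsc : LowerSemicontinuous fun μ : PV 𝒳 => rateKary k Q μ.1 :=
    KaryTree.lowerSemicontinuous_rateKary hk hQ_nonneg hQ_sum
  refine ⟨fun x h0 h1 => KaryTree.cramerRate_karyLaw hk h0 h1, hlsc, fun c => ?_,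
    fun F hF => ?_, fun O hO => ?_⟩
  · exact (hlsc.isClosed_preimage (c : EReal)).isCompact
  · exact KaryTree.limsup_elog_condP_le hk hμ0_nonneg hμ0_sum hQ_nonneg hQ_sum hQ_irr hF
  · exact KaryTree.le_liminf_elog_condP hk hμ0_nonneg hμ0_sum hQ_nonneg hQ_sum hQ_irr hO

end Statement2
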